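/- arXiv:2407.09903 — 5 statements merged into one kernel-verified Lean document; each statement's English description precedes it below -/
import Mathlib

section
/- Let γ ≥ -1/2, n ≥ 1, and let P be a real polynomial in two variables of total degree ≤ n−1 such that ∫_{[-1,1]²} P(y₁+y₂, y₁y₂) g(y₁+y₂, y₁y₂) w(y₁)w(y₂) (1−y₁²)(1−y₂²) |y₁−y₂|^{2γ+1} dy₁dy₂ = 0 for every real polynomial g in two variables of total degree ≤ n−2. Then the polynomial Q(x₁,x₂) := (x₁²−x₂²)·P(2x₁x₂, x₁²+x₂²−1), of total degree ≤ 2n, satisfies ∫_{[-1,1]²} Q(x₁,x₂) h(x₁,x₂) W_γ(x₁,x₂) dx₁dx₂ = 0 for every real polynomial h in two variables of total degree ≤ 2n−1. -/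
open MeasureTheory Set

noncomputable section

/-- The weight `W_γ` on the square `[-1,1]²`, with `θᵢ = arccos xᵢ`. -/
def Wsq (w : ℝ → ℝ) (γ : ℝ) (x : ℝ × ℝ) : ℝ :=
  w (Real.cos (Real.arccos x.1 - Real.arccos x.2)) *
  w (Real.cos (Real.arccos x.1 + Real.arccos x.2)) *
  (1 - x.1 ^ 2) ^ γ * (1 - x.2 ^ 2) ^ γ * |x.1 ^ 2 - x.2 ^ 2|
theorem totalDegree_bind₁_le {σ τ R : Type*} [CommSemiring R] (f : σ → MvPolynomial τ R) {d : ℕ}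
    (hf : ∀ i, (f i).totalDegree ≤ d) (p : MvPolynomial σ R) :
    (MvPolynomial.bind₁ f p).totalDegree ≤ p.totalDegree * d := by
  rw [MvPolynomial.bind₁, MvPolynomial.aeval_def, MvPolynomial.eval₂_eq]
  refine MvPolynomial.totalDegree_finsetSum_le fun m hm => ?_
  refine (MvPolynomial.totalDegree_mul _ _).trans ?_
  rw [MvPolynomial.algebraMap_eq, MvPolynomial.totalDegree_C, zero_add]
  refine (MvPolynomial.totalDegree_finsetProd _ _).trans ?_
  calc ∑ i ∈ m.support, (f i ^ m i).totalDegree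
      ≤ ∑ i ∈ m.support, m i * d := by
        refine Finset.sum_le_sum fun i _ => (MvPolynomial.totalDegree_pow _ _).trans ?_
        exact Nat.mul_le_mul_left _ (hf i)
    _ = (m.sum fun _ e => e) * d := by rw [Finsupp.sum, Finset.sum_mul]
    _ ≤ p.totalDegree * d := Nat.mul_le_mul_right _ (MvPolynomial.le_totalDegree hm)

theorem exists_pow_sub_pow_eq (k : ℕ) :
    ∃ g : MvPolynomial (Fin 2) ℝ, g.totalDegree ≤ k - 1 ∧ (k = 0 → g = 0) ∧ ∀ x y : ℝ,
      x ^ (2 * k) - y ^ (2 * k) =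
        (x ^ 2 - y ^ 2) * MvPolynomial.eval ![2 * x * y, x ^ 2 + y ^ 2 - 1] g := by
  induction k using Nat.twoStepInduction with
  | zero => exact ⟨0, by simp, by simp, by simp⟩
  | one => exact ⟨1, by simp, by simp, by simp⟩
  | more k ih₀ ih₁ =>
    obtain ⟨g₀, hd₀, hz₀, he₀⟩ := ih₀
    obtain ⟨g₁, hd₁, -, he₁⟩ := ih₁
    have hs : (MvPolynomial.X 1 + 1 : MvPolynomial (Fin 2) ℝ).totalDegree ≤ 1 :=
      (MvPolynomial.totalDegree_add _ _).trans (by simp)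
    have hp : (MvPolynomial.C (1 / 4) * MvPolynomial.X 0 ^ 2 :
        MvPolynomial (Fin 2) ℝ).totalDegree ≤ 2 :=
      (MvPolynomial.totalDegree_mul _ _).trans (by simp)
    refine ⟨(MvPolynomial.X 1 + 1) * g₁ - MvPolynomial.C (1 / 4) * MvPolynomial.X 0 ^ 2 * g₀,
      ?_, by omega, fun x y => ?_⟩
    · refine (MvPolynomial.totalDegree_sub _ _).trans (max_le ?_ ?_)
      · exact (MvPolynomial.totalDegree_mul _ _).trans (by omega)
      · rcases Nat.eq_zero_or_pos k with hk | hk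
        · simp [hz₀ hk]
        · exact (MvPolynomial.totalDegree_mul _ _).trans (by omega)
    · have h₀ := he₀ x y
      have h₁ := he₁ x y
      simp only [map_sub, map_mul, map_add, map_one, map_pow, MvPolynomial.eval_X,
        MvPolynomial.eval_C, Matrix.cons_val_zero, Matrix.cons_val_one]
      linear_combination (x ^ 2 + y ^ 2) * h₁ - x ^ 2 * y ^ 2 * h₀

theorem exists_antisymm_monomial (a b n : ℕ) (hab : a + b ≤ 2 * n - 1) :
    ∃ g : MvPolynomial (Fin 2) ℝ, g.totalDegree ≤ n - 2 ∧ ∀ x y : ℝ,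
      x ^ a * y ^ b - y ^ a * x ^ b + (-x) ^ a * (-y) ^ b - (-y) ^ a * (-x) ^ b =
        (x ^ 2 - y ^ 2) * MvPolynomial.eval ![2 * x * y, x ^ 2 + y ^ 2 - 1] g := by
  wlog hle : b ≤ a generalizing a b
  · obtain ⟨g, hd, he⟩ := this b a (by omega) (by omega)
    exact ⟨-g, by rwa [MvPolynomial.totalDegree_neg], fun x y => by
      rw [map_neg]; linear_combination -he x y⟩
  rcases Nat.even_or_odd' (a - b) with ⟨k, hk | hk⟩
  · obtain ⟨g, hd, hz, he⟩ := exists_pow_sub_pow_eq k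
    have hb : (MvPolynomial.C (2 * (1 / 2) ^ b) * MvPolynomial.X 0 ^ b :
        MvPolynomial (Fin 2) ℝ).totalDegree ≤ b :=
      (MvPolynomial.totalDegree_mul _ _).trans (by
        rw [MvPolynomial.totalDegree_C, MvPolynomial.totalDegree_X_pow, zero_add])
    refine ⟨MvPolynomial.C (2 * (1 / 2) ^ b) * MvPolynomial.X 0 ^ b * g, ?_, fun x y => ?_⟩
    · rcases Nat.eq_zero_or_pos k with hk0 | hk0
      · simp [hz hk0]
      · exact (MvPolynomial.totalDegree_mul _ _).trans (by omega)
    · obtain rfl : a = b + 2 * k := by omega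
      simp only [map_mul, map_pow, MvPolynomial.eval_X, MvPolynomial.eval_C,
        Matrix.cons_val_zero]
      have h2 : (1 / 2 : ℝ) ^ b * (2 * x * y) ^ b = (x * y) ^ b := by
        rw [← mul_pow]; congr 1; ring
      have hneg : ∀ u v : ℝ, (-u) ^ (b + 2 * k) * (-v) ^ b = u ^ (b + 2 * k) * v ^ b := by
        intro u v
        rw [pow_add, mul_right_comm, ← mul_pow, (even_two_mul k).neg_pow, neg_mul_neg, pow_add,
          mul_pow]
        ring
      rw [hneg, hneg]
      linear_combination (2 * (x * y) ^ b) * he x y -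
        (2 * (x ^ 2 - y ^ 2) * MvPolynomial.eval ![2 * x * y, x ^ 2 + y ^ 2 - 1] g) * h2
  · refine ⟨0, by simp, fun x y => ?_⟩
    obtain rfl : a = b + (2 * k + 1) := by omega
    have hneg : ∀ u v : ℝ, (-u) ^ (b + (2 * k + 1)) * (-v) ^ b =
        -(u ^ (b + (2 * k + 1)) * v ^ b) := by
        intro u v
        rw [pow_add, mul_right_comm, ← mul_pow, (odd_two_mul_add_one k).neg_pow, neg_mul_neg,
          pow_add, mul_pow]
        ring
    rw [hneg, hneg, map_zero]
    ring

theorem exists_antisymm (n : ℕ) (h : MvPolynomial (Fin 2) ℝ) (hh : h.totalDegree ≤ 2 * n - 1) :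
    ∃ g : MvPolynomial (Fin 2) ℝ, g.totalDegree ≤ n - 2 ∧ ∀ x y : ℝ,
      MvPolynomial.eval ![x, y] h - MvPolynomial.eval ![y, x] h +
        MvPolynomial.eval ![-x, -y] h - MvPolynomial.eval ![-y, -x] h =
        (x ^ 2 - y ^ 2) * MvPolynomial.eval ![2 * x * y, x ^ 2 + y ^ 2 - 1] g := by
  have key : ∀ m : Fin 2 →₀ ℕ, ∃ g : MvPolynomial (Fin 2) ℝ, m ∈ h.support →
      g.totalDegree ≤ n - 2 ∧ ∀ x y : ℝ,
      x ^ m 0 * y ^ m 1 - y ^ m 0 * x ^ m 1 + (-x) ^ m 0 * (-y) ^ m 1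
        - (-y) ^ m 0 * (-x) ^ m 1 =
        (x ^ 2 - y ^ 2) * MvPolynomial.eval ![2 * x * y, x ^ 2 + y ^ 2 - 1] g := by
    intro m
    by_cases hm : m ∈ h.support
    · have hdeg := (MvPolynomial.le_totalDegree hm).trans hh
      rw [Finsupp.sum_fintype _ _ (fun _ => rfl), Fin.sum_univ_two] at hdeg
      obtain ⟨g, hg⟩ := exists_antisymm_monomial _ _ n hdeg
      exact ⟨g, fun _ => hg⟩
    · exact ⟨0, fun h => absurd h hm⟩
  choose G hG using key
  refine ⟨∑ m ∈ h.support, MvPolynomial.C (h.coeff m) * G m,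
    MvPolynomial.totalDegree_finsetSum_le fun m hm => ?_, fun x y => ?_⟩
  · refine (MvPolynomial.totalDegree_mul _ _).trans ?_
    rw [MvPolynomial.totalDegree_C, zero_add]
    exact (hG m hm).1
  · simp only [MvPolynomial.eval_eq' _ h, map_sum, map_mul, MvPolynomial.eval_C, Fin.prod_univ_two,
      Matrix.cons_val_zero, Matrix.cons_val_one, Finset.mul_sum]
    rw [← Finset.sum_sub_distrib, ← Finset.sum_add_distrib, ← Finset.sum_sub_distrib]
    refine Finset.sum_congr rfl fun m hm => ?_
    linear_combination h.coeff m * (hG m hm).2 x y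

theorem integrableOn_preimage_iff_of_involutive {α : Type*} [MeasurableSpace α] {μ : Measure α}
    {e : α ≃ᵐ α} (he : MeasurePreserving e μ μ) (hinv : Function.Involutive e)
    {A : Set α} {F : α → ℝ} :
    IntegrableOn F (e ⁻¹' A) μ ↔ IntegrableOn (fun x => F (e x)) A μ := by
  rw [← he.integrableOn_comp_preimage (f := fun x => F (e x)) e.measurableEmbedding]
  simp only [Function.comp_def, hinv _]

theorem setIntegral_preimage_of_involutive {α : Type*} [MeasurableSpace α] {μ : Measure α}
    {e : α ≃ᵐ α} (he : MeasurePreserving e μ μ) (hinv : Function.Involutive e)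
    (A : Set α) (F : α → ℝ) :
    ∫ x in e ⁻¹' A, F x ∂μ = ∫ x in A, F (e x) ∂μ := by
  rw [← he.setIntegral_preimage_emb e.measurableEmbedding (fun x => F (e x))]
  simp only [hinv _]

/-- Folding an integral along a measure-preserving involution. -/
theorem setIntegral_fold {α : Type*} [MeasurableSpace α] {μ : Measure α}
    {e : α ≃ᵐ α} (he : MeasurePreserving e μ μ) (hinv : Function.Involutive e)
    {S A : Set α} (hA : MeasurableSet A) (hdisj : Disjoint A (e ⁻¹' A))
    (hS : (A ∪ e ⁻¹' A : Set α) =ᵐ[μ] S) {F : α → ℝ} (hF : IntegrableOn F S μ) :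
    IntegrableOn (fun x => F x + F (e x)) A μ ∧
      ∫ x in S, F x ∂μ = ∫ x in A, (F x + F (e x)) ∂μ := by
  rw [integrableOn_congr_set_ae hS.symm] at hF
  have h₁ : IntegrableOn F A μ := hF.left_of_union
  have h₂ : IntegrableOn F (e ⁻¹' A) μ := hF.right_of_union
  have h₃ := (integrableOn_preimage_iff_of_involutive he hinv).1 h₂
  refine ⟨h₁.add h₃, ?_⟩
  rw [setIntegral_congr_set hS.symm, setIntegral_union hdisj (e.measurable hA) h₁ h₂,
    setIntegral_preimage_of_involutive he hinv, integral_add h₁ h₃]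

theorem setIntegral_fold_eq_zero {α : Type*} [MeasurableSpace α] {μ : Measure α}
    {e : α ≃ᵐ α} (he : MeasurePreserving e μ μ) (hinv : Function.Involutive e)
    {S A : Set α} (hA : MeasurableSet A) (hdisj : Disjoint A (e ⁻¹' A))
    (hS : (A ∪ e ⁻¹' A : Set α) =ᵐ[μ] S) {F : α → ℝ} (hFe : ∀ x, F (e x) = F x)
    (hF : ∫ x in S, F x ∂μ = 0) : ∫ x in A, F x ∂μ = 0 := by
  by_cases hint : IntegrableOn F A μ
  · have h₂ : IntegrableOn F (e ⁻¹' A) μ := by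
      rw [integrableOn_preimage_iff_of_involutive he hinv]
      simpa only [hFe] using hint
    have h₃ : IntegrableOn F S μ := (integrableOn_congr_set_ae hS).1 (hint.union h₂)
    have h₄ := (setIntegral_fold he hinv hA hdisj hS h₃).2
    simp only [hFe] at h₄
    rw [hF, integral_add hint hint] at h₄
    linarith
  · exact integral_undef hint

theorem volume_linear_eq_zero (a b : ℝ) (hab : (a, b) ≠ 0) :
    volume {x : ℝ × ℝ | a * x.1 + b * x.2 = 0} = 0 := by
  have h := Measure.addHaar_submodule (volume : Measure (ℝ × ℝ))
    (LinearMap.ker (a • LinearMap.fst ℝ ℝ ℝ + b • LinearMap.snd ℝ ℝ ℝ)) (fun htop => hab ?_)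
  · convert h using 2
    ext x
    simp
  · rw [LinearMap.ker_eq_top] at htop
    have h₁ := LinearMap.congr_fun htop (1, 0)
    have h₂ := LinearMap.congr_fun htop (0, 1)
    simpa using And.intro h₁ h₂

/-- The part of the open square `(-1,1)²` below the diagonal. -/
def lowerTriangle : Set (ℝ × ℝ) := {x | -1 < x.2 ∧ x.2 < x.1 ∧ x.1 < 1}

/-- The part of the open square `(-1,1)²` below both diagonals and above the antidiagonal. -/
def rightTriangle : Set (ℝ × ℝ) := {x | -x.1 < x.2 ∧ x.2 < x.1 ∧ x.1 < 1}

/-- The parameter triangle for the angles `(θ₁, θ₂)`. -/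
def angleTriangle : Set (ℝ × ℝ) := {t | 0 < t.1 ∧ t.1 < t.2 ∧ t.1 + t.2 < Real.pi}

theorem measurableSet_lowerTriangle : MeasurableSet lowerTriangle := by
  unfold lowerTriangle
  refine IsOpen.measurableSet (IsOpen.and ?_ (IsOpen.and ?_ ?_)) <;>
    exact isOpen_lt (by fun_prop) (by fun_prop)

theorem measurableSet_rightTriangle : MeasurableSet rightTriangle := by
  unfold rightTriangle
  refine IsOpen.measurableSet (IsOpen.and ?_ (IsOpen.and ?_ ?_)) <;>
    exact isOpen_lt (by fun_prop) (by fun_prop)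

theorem measurableSet_angleTriangle : MeasurableSet angleTriangle := by
  unfold angleTriangle
  refine IsOpen.measurableSet (IsOpen.and ?_ (IsOpen.and ?_ ?_)) <;>
    exact isOpen_lt (by fun_prop) (by fun_prop)

/-- Reflection of the plane in the antidiagonal. -/
def antiSwap : ℝ × ℝ ≃ᵐ ℝ × ℝ := MeasurableEquiv.prodComm.trans (MeasurableEquiv.neg (ℝ × ℝ))

theorem antiSwap_apply (x : ℝ × ℝ) : antiSwap x = (-x.2, -x.1) := rfl

theorem measurePreserving_prodComm_volume :
    MeasurePreserving (MeasurableEquiv.prodComm : ℝ × ℝ ≃ᵐ ℝ × ℝ) volume volume :=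
  Measure.measurePreserving_swap

theorem measurePreserving_antiSwap : MeasurePreserving antiSwap volume volume :=
  (Measure.measurePreserving_neg (volume : Measure (ℝ × ℝ))).comp measurePreserving_prodComm_volume

theorem lowerTriangle_union_ae_eq_square :
    (lowerTriangle ∪ (MeasurableEquiv.prodComm : ℝ × ℝ ≃ᵐ ℝ × ℝ) ⁻¹' lowerTriangle : Set (ℝ × ℝ))
      =ᵐ[volume] (Icc (-1 : ℝ) 1 ×ˢ Icc (-1 : ℝ) 1 : Set (ℝ × ℝ)) := by
  have h : (Ioo (-1 : ℝ) 1 ×ˢ Ioo (-1 : ℝ) 1 : Set (ℝ × ℝ)) =ᵐ[volume]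
      (Icc (-1 : ℝ) 1 ×ˢ Icc (-1 : ℝ) 1 : Set (ℝ × ℝ)) :=
    Measure.set_prod_ae_eq Ioo_ae_eq_Icc Ioo_ae_eq_Icc
  refine Filter.EventuallyEq.trans ?_ h
  have hd : ∀ᵐ x : ℝ × ℝ, ¬ (1 * x.1 + (-1) * x.2 = 0) :=
    measure_eq_zero_iff_ae_notMem.1 (volume_linear_eq_zero 1 (-1) (by simp))
  filter_upwards [hd] with x hx
  refine propext ⟨?_, ?_⟩
  · rintro (⟨h₁, h₂, h₃⟩ | ⟨h₁, h₂, h₃⟩)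
    · exact ⟨⟨by linarith, by linarith⟩, by linarith, by linarith⟩
    · change -1 < x.1 at h₁
      change x.1 < x.2 at h₂
      change x.2 < 1 at h₃
      exact ⟨⟨by linarith, by linarith⟩, by linarith, by linarith⟩
  · rintro ⟨⟨h₁, h₂⟩, h₃, h₄⟩
    rcases lt_trichotomy x.1 x.2 with h | h | h
    · exact Or.inr ⟨h₁, h, h₄⟩
    · exact absurd (by linarith) hx
    · exact Or.inl ⟨h₃, h, h₂⟩

theorem rightTriangle_union_ae_eq_lowerTriangle :
    (rightTriangle ∪ antiSwap ⁻¹' rightTriangle : Set (ℝ × ℝ)) =ᵐ[volume] lowerTriangle := by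
  have hd : ∀ᵐ x : ℝ × ℝ, ¬ (1 * x.1 + 1 * x.2 = 0) :=
    measure_eq_zero_iff_ae_notMem.1 (volume_linear_eq_zero 1 1 (by simp))
  filter_upwards [hd] with x hx
  refine propext ⟨?_, ?_⟩
  · rintro (⟨h₁, h₂, h₃⟩ | ⟨h₁, h₂, h₃⟩)
    · exact ⟨by linarith, by linarith, by linarith⟩
    · rw [antiSwap_apply] at h₁ h₂ h₃
      exact ⟨by linarith, by linarith, by linarith⟩
  · rintro ⟨h₁, h₂, h₃⟩
    rcases lt_trichotomy (x.1 + x.2) 0 with h | h | h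
    · refine Or.inr ⟨?_, ?_, ?_⟩ <;> rw [antiSwap_apply] <;> dsimp only <;> linarith
    · exact absurd (by linarith) hx
    · exact Or.inl ⟨by linarith, h₂, h₃⟩

theorem disjoint_lowerTriangle :
    Disjoint lowerTriangle ((MeasurableEquiv.prodComm : ℝ × ℝ ≃ᵐ ℝ × ℝ) ⁻¹' lowerTriangle) :=
  disjoint_left.2 fun x h h' => by
    have h₁ : x.2 < x.1 := h.2.1
    have h₂ : x.1 < x.2 := h'.2.1
    exact lt_asymm h₁ h₂

theorem disjoint_rightTriangle : Disjoint rightTriangle (antiSwap ⁻¹' rightTriangle) :=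
  disjoint_left.2 fun x h h' => by
    have h₁ : -x.1 < x.2 := h.1
    have h₂ : - -x.2 < -x.1 := h'.1
    linarith

/-- The parametrisation `(θ₁, θ₂) ↦ (cos θ₁, cos θ₂)`. -/
def cosMap (t : ℝ × ℝ) : ℝ × ℝ := (Real.cos t.1, Real.cos t.2)

/-- The parametrisation `(θ₁, θ₂) ↦ (cos (θ₁ - θ₂), cos (θ₁ + θ₂))`. -/
def cosSubAddMap (t : ℝ × ℝ) : ℝ × ℝ := (Real.cos (t.1 - t.2), Real.cos (t.1 + t.2))

theorem hasFDerivAt_cosMap (t : ℝ × ℝ) :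
    HasFDerivAt cosMap (Matrix.toLin (.finTwoProd ℝ) (.finTwoProd ℝ)
      !![-Real.sin t.1, 0; 0, -Real.sin t.2]).toContinuousLinearMap t := by
  rw [Matrix.toLin_finTwoProd_toContinuousLinearMap]
  convert!
    HasFDerivAt.prodMk (𝕜 := ℝ)
      ((Real.hasDerivAt_cos t.1).comp_hasFDerivAt t hasFDerivAt_fst)
      ((Real.hasDerivAt_cos t.2).comp_hasFDerivAt t hasFDerivAt_snd) using 2 <;> ext <;> simp

theorem hasFDerivAt_cosSubAddMap (t : ℝ × ℝ) :
    HasFDerivAt cosSubAddMap (Matrix.toLin (.finTwoProd ℝ) (.finTwoProd ℝ)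
      !![-Real.sin (t.1 - t.2), Real.sin (t.1 - t.2);
        -Real.sin (t.1 + t.2), -Real.sin (t.1 + t.2)]).toContinuousLinearMap t := by
  have hsub : HasFDerivAt (fun t : ℝ × ℝ => t.1 - t.2)
      (ContinuousLinearMap.fst ℝ ℝ ℝ - ContinuousLinearMap.snd ℝ ℝ ℝ) t :=
    hasFDerivAt_fst.sub hasFDerivAt_snd
  have hadd : HasFDerivAt (fun t : ℝ × ℝ => t.1 + t.2)
      (ContinuousLinearMap.fst ℝ ℝ ℝ + ContinuousLinearMap.snd ℝ ℝ ℝ) t :=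
    hasFDerivAt_fst.add hasFDerivAt_snd
  rw [Matrix.toLin_finTwoProd_toContinuousLinearMap]
  convert! HasFDerivAt.prodMk (𝕜 := ℝ) hsub.cos hadd.cos using 2 <;> ext <;> simp

theorem injOn_cosMap : InjOn cosMap angleTriangle := by
  rintro ⟨s₁, s₂⟩ ⟨h₁, h₂, h₃⟩ ⟨t₁, t₂⟩ ⟨k₁, k₂, k₃⟩ h
  simp only [cosMap, Prod.mk.injEq] at *
  exact ⟨Real.injOn_cos ⟨by linarith, by linarith⟩ ⟨by linarith, by linarith⟩ h.1,
    Real.injOn_cos ⟨by linarith, by linarith⟩ ⟨by linarith, by linarith⟩ h.2⟩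

theorem injOn_cosSubAddMap : InjOn cosSubAddMap angleTriangle := by
  rintro ⟨s₁, s₂⟩ ⟨h₁, h₂, h₃⟩ ⟨t₁, t₂⟩ ⟨k₁, k₂, k₃⟩ h
  simp only [cosSubAddMap, Prod.mk.injEq] at *
  rw [← Real.cos_neg (s₁ - s₂), ← Real.cos_neg (t₁ - t₂)] at h
  have e₁ := Real.injOn_cos ⟨by linarith, by linarith⟩ ⟨by linarith, by linarith⟩ h.1
  have e₂ := Real.injOn_cos ⟨by linarith, by linarith⟩ ⟨by linarith, by linarith⟩ h.2
  exact ⟨by linarith, by linarith⟩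

theorem image_cosMap : image cosMap angleTriangle = rightTriangle := by
  ext ⟨x₁, x₂⟩
  constructor
  · rintro ⟨⟨t₁, t₂⟩, ⟨h₁, h₂, h₃⟩, h⟩
    simp only [cosMap, Prod.mk.injEq] at *
    obtain ⟨rfl, rfl⟩ := h
    refine ⟨?_, Real.cos_lt_cos_of_nonneg_of_le_pi (by linarith) (by linarith) h₂, ?_⟩
    · rw [← Real.cos_pi_sub]
      exact Real.cos_lt_cos_of_nonneg_of_le_pi (by linarith) (by linarith) (by linarith)
    · rw [← Real.cos_zero]
      exact Real.cos_lt_cos_of_nonneg_of_le_pi (by linarith) (by linarith) (by linarith)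
  · rintro ⟨h₁, h₂, h₃⟩
    dsimp only at h₁ h₂ h₃
    refine ⟨(Real.arccos x₁, Real.arccos x₂), ⟨Real.arccos_pos.2 h₃, ?_, ?_⟩, ?_⟩
    · exact Real.arccos_lt_arccos (by linarith) h₂ (by linarith)
    · have := Real.arccos_lt_arccos (x := -x₁) (y := x₂) (by linarith) h₁ (by linarith)
      rw [Real.arccos_neg] at this
      dsimp only
      linarith
    · simp only [cosMap]
      rw [Real.cos_arccos (by linarith) (by linarith), Real.cos_arccos (by linarith) (by linarith)]

theorem image_cosSubAddMap : image cosSubAddMap angleTriangle = lowerTriangle := by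
  ext ⟨x₁, x₂⟩
  constructor
  · rintro ⟨⟨t₁, t₂⟩, ⟨h₁, h₂, h₃⟩, h⟩
    simp only [cosSubAddMap, Prod.mk.injEq] at *
    rw [← Real.cos_neg (t₁ - t₂)] at h
    obtain ⟨rfl, rfl⟩ := h
    refine ⟨?_, Real.cos_lt_cos_of_nonneg_of_le_pi (by linarith) (by linarith) (by linarith), ?_⟩
    · rw [← Real.cos_pi]
      exact Real.cos_lt_cos_of_nonneg_of_le_pi (by linarith) (by linarith) (by linarith)
    · rw [← Real.cos_zero]
      exact Real.cos_lt_cos_of_nonneg_of_le_pi (by linarith) (by linarith) (by linarith)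
  · rintro ⟨h₁, h₂, h₃⟩
    dsimp only at h₁ h₂ h₃
    have k₁ := Real.arccos_pos.2 h₃
    have k₂ := Real.arccos_lt_arccos (by linarith) h₂ (by linarith)
    have k₃ := Real.arccos_lt_arccos le_rfl h₁ (by linarith)
    rw [Real.arccos_neg_one] at k₃
    refine ⟨((Real.arccos x₂ - Real.arccos x₁) / 2, (Real.arccos x₂ + Real.arccos x₁) / 2),
      ⟨by dsimp only; linarith, by dsimp only; linarith, by dsimp only; linarith⟩, ?_⟩
    simp only [cosSubAddMap, Prod.mk.injEq]
    constructor
    · rw [← Real.cos_neg, show -((Real.arccos x₂ - Real.arccos x₁) / 2 -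
        (Real.arccos x₂ + Real.arccos x₁) / 2) = Real.arccos x₁ by ring,
        Real.cos_arccos (by linarith) (by linarith)]
    · rw [show (Real.arccos x₂ - Real.arccos x₁) / 2 +
        (Real.arccos x₂ + Real.arccos x₁) / 2 = Real.arccos x₂ by ring,
        Real.cos_arccos (by linarith) (by linarith)]

theorem setIntegral_rightTriangle (F : ℝ × ℝ → ℝ) :
    ∫ x in rightTriangle, F x =
      ∫ t in angleTriangle, |Real.sin t.1 * Real.sin t.2| * F (cosMap t) := by
  rw [← image_cosMap, integral_image_eq_integral_abs_det_fderiv_smul volume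
    measurableSet_angleTriangle (fun t _ => (hasFDerivAt_cosMap t).hasFDerivWithinAt) injOn_cosMap]
  simp [LinearMap.det_toLin, Matrix.det_fin_two_of]

theorem setIntegral_lowerTriangle (F : ℝ × ℝ → ℝ) :
    ∫ y in lowerTriangle, F y =
      ∫ t in angleTriangle,
        |2 * (Real.sin (t.1 - t.2) * Real.sin (t.1 + t.2))| * F (cosSubAddMap t) := by
  rw [← image_cosSubAddMap, integral_image_eq_integral_abs_det_fderiv_smul volume
    measurableSet_angleTriangle (fun t _ => (hasFDerivAt_cosSubAddMap t).hasFDerivWithinAt)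
    injOn_cosSubAddMap]
  refine integral_congr_ae (Filter.Eventually.of_forall fun t => ?_)
  simp only [LinearMap.det_toContinuousLinearMap, LinearMap.det_toLin, Matrix.det_fin_two_of,
    smul_eq_mul]
  congr 2
  ring

theorem sin_rpow_identity {γ s t : ℝ} (hs : 0 < s) (ht : 0 < t) :
    s * t * ((s ^ 2) ^ γ * (t ^ 2) ^ γ) = 2⁻¹ ^ (2 * γ + 1) * (2 * s * t) ^ (2 * γ + 1) := by
  rw [← Real.mul_rpow (by positivity) (by positivity),
    ← Real.mul_rpow (by positivity) (by positivity),
    show 2⁻¹ * (2 * s * t) = s * t by ring, Real.rpow_add (by positivity), Real.rpow_one,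
    ← mul_pow, Real.rpow_mul (by positivity), Real.rpow_two, mul_comm]

theorem Wsq_swap (w : ℝ → ℝ) (γ a b : ℝ) : Wsq w γ (b, a) = Wsq w γ (a, b) := by
  simp only [Wsq]
  rw [← Real.cos_neg (Real.arccos b - Real.arccos a), neg_sub, add_comm (Real.arccos b),
    abs_sub_comm (b ^ 2)]
  ring

theorem Wsq_neg (w : ℝ → ℝ) (γ a b : ℝ) : Wsq w γ (-a, -b) = Wsq w γ (a, b) := by
  simp only [Wsq, Real.arccos_neg, neg_sq]
  rw [show Real.pi - Real.arccos a - (Real.pi - Real.arccos b) =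
      -(Real.arccos a - Real.arccos b) by ring, Real.cos_neg,
    show Real.pi - Real.arccos a + (Real.pi - Real.arccos b) =
      2 * Real.pi - (Real.arccos a + Real.arccos b) by ring, Real.cos_two_pi_sub]

theorem Wsq_cosMap (w : ℝ → ℝ) (γ : ℝ) {t : ℝ × ℝ} (ht : t ∈ angleTriangle) :
    Wsq w γ (cosMap t) = w (Real.cos (t.1 - t.2)) * w (Real.cos (t.1 + t.2)) *
      (Real.sin t.1 ^ 2) ^ γ * (Real.sin t.2 ^ 2) ^ γ *
      |Real.sin (t.1 - t.2) * Real.sin (t.1 + t.2)| := by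
  obtain ⟨h₁, h₂, h₃⟩ := ht
  have hD : Real.cos t.1 ^ 2 - Real.cos t.2 ^ 2 =
      -(Real.sin (t.1 - t.2) * Real.sin (t.1 + t.2)) := by
    rw [Real.sin_sub, Real.sin_add]
    linear_combination (Real.cos t.2 ^ 2) * Real.sin_sq_add_cos_sq t.1 -
      (Real.cos t.1 ^ 2) * Real.sin_sq_add_cos_sq t.2
  simp only [Wsq, cosMap]
  rw [Real.arccos_cos h₁.le (by linarith), Real.arccos_cos (by linarith) (by linarith),
    ← Real.sin_sq, ← Real.sin_sq, hD, abs_neg]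

/-- The density identity behind the change of variables from the square weight to the
weight in the variables `cos (θ₁ ∓ θ₂)`. -/
theorem density_identity (w : ℝ → ℝ) (γ p g : ℝ) {t : ℝ × ℝ} (ht : t ∈ angleTriangle) :
    |Real.sin t.1 * Real.sin t.2| *
        (((cosMap t).1 ^ 2 - (cosMap t).2 ^ 2) ^ 2 * p * g * Wsq w γ (cosMap t)) =
      2⁻¹ * 2⁻¹ ^ (2 * γ + 1) * (|2 * (Real.sin (t.1 - t.2) * Real.sin (t.1 + t.2))| *
        (p * g * (w (cosSubAddMap t).1 * w (cosSubAddMap t).2 *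
          ((1 - (cosSubAddMap t).1 ^ 2) * (1 - (cosSubAddMap t).2 ^ 2) *
            |(cosSubAddMap t).1 - (cosSubAddMap t).2| ^ (2 * γ + 1))))) := by
  rw [Wsq_cosMap w γ ht]
  obtain ⟨h₁, h₂, h₃⟩ := ht
  have hs₁ : 0 < Real.sin t.1 := Real.sin_pos_of_pos_of_lt_pi h₁ (by linarith)
  have hs₂ : 0 < Real.sin t.2 := Real.sin_pos_of_pos_of_lt_pi (by linarith) (by linarith)
  have hD : (Real.cos t.1 ^ 2 - Real.cos t.2 ^ 2) ^ 2 =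
      Real.sin (t.1 - t.2) ^ 2 * Real.sin (t.1 + t.2) ^ 2 := by
    rw [← mul_pow, ← neg_sq (Real.sin (t.1 - t.2) * _)]
    congr 1
    rw [Real.sin_sub, Real.sin_add]
    linear_combination (Real.cos t.2 ^ 2) * Real.sin_sq_add_cos_sq t.1 -
      (Real.cos t.1 ^ 2) * Real.sin_sq_add_cos_sq t.2
  have hdiff : Real.cos (t.1 - t.2) - Real.cos (t.1 + t.2) = 2 * Real.sin t.1 * Real.sin t.2 := by
    rw [Real.cos_sub, Real.cos_add]
    ring
  simp only [cosMap, cosSubAddMap]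
  rw [hD, hdiff, ← Real.sin_sq, ← Real.sin_sq, abs_mul (2 : ℝ), abs_two,
    abs_of_pos (by positivity : 0 < Real.sin t.1 * Real.sin t.2),
    abs_of_pos (by positivity : 0 < 2 * Real.sin t.1 * Real.sin t.2)]
  linear_combination (Real.sin (t.1 - t.2) ^ 2 * Real.sin (t.1 + t.2) ^ 2 * p * g *
    (w (Real.cos (t.1 - t.2)) * w (Real.cos (t.1 + t.2))) *
    |Real.sin (t.1 - t.2) * Real.sin (t.1 + t.2)|) * sin_rpow_identity (γ := γ) hs₁ hs₂

theorem eval_cosMap_eq_eval_cosSubAddMap (p : MvPolynomial (Fin 2) ℝ) (t : ℝ × ℝ) :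
    MvPolynomial.eval ![2 * (cosMap t).1 * (cosMap t).2,
        (cosMap t).1 ^ 2 + (cosMap t).2 ^ 2 - 1] p =
      MvPolynomial.eval ![(cosSubAddMap t).1 + (cosSubAddMap t).2,
        (cosSubAddMap t).1 * (cosSubAddMap t).2] p := by
  simp only [cosMap, cosSubAddMap]
  rw [Real.cos_sub, Real.cos_add]
  congr 3
  · ring
  · congr 1
    linear_combination Real.sin t.2 ^ 2 * Real.sin_sq_add_cos_sq t.1 +
      (1 - Real.cos t.1 ^ 2) * Real.sin_sq_add_cos_sq t.2

theorem stmt10 (w : ℝ → ℝ)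
    (hw_nonneg : ∀ t ∈ Icc (-1:ℝ) 1, 0 ≤ w t)
    (hw_int : IntegrableOn w (Icc (-1:ℝ) 1))
    (hw_ne : ¬ (w =ᵐ[volume.restrict (Icc (-1:ℝ) 1)] 0))
    (γ : ℝ) (hγ : -1/2 ≤ γ)
    (n : ℕ) (hn : 1 ≤ n)
    (P : MvPolynomial (Fin 2) ℝ) (hPdeg : P.totalDegree ≤ n - 1)
    (hPorth : ∀ g : MvPolynomial (Fin 2) ℝ, g.totalDegree ≤ n - 2 →
      (∫ y in (Icc (-1:ℝ) 1) ×ˢ (Icc (-1:ℝ) 1),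
        MvPolynomial.eval ![y.1 + y.2, y.1 * y.2] P *
          MvPolynomial.eval ![y.1 + y.2, y.1 * y.2] g *
          (w y.1 * w y.2 * ((1 - y.1 ^ 2) * (1 - y.2 ^ 2) * |y.1 - y.2| ^ (2*γ+1)))) = 0) :
    ∃ Q : MvPolynomial (Fin 2) ℝ, Q.totalDegree ≤ 2*n ∧
      (∀ x₁ x₂ : ℝ, MvPolynomial.eval ![x₁, x₂] Q =
        (x₁ ^ 2 - x₂ ^ 2) * MvPolynomial.eval ![2 * x₁ * x₂, x₁ ^ 2 + x₂ ^ 2 - 1] P) ∧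
      (∀ h : MvPolynomial (Fin 2) ℝ, h.totalDegree ≤ 2*n - 1 →
        (∫ x in (Icc (-1:ℝ) 1) ×ˢ (Icc (-1:ℝ) 1),
          MvPolynomial.eval ![x.1, x.2] Q * MvPolynomial.eval ![x.1, x.2] h *
            Wsq w γ x) = 0) := by
  have hQX : (MvPolynomial.X 0 ^ 2 - MvPolynomial.X 1 ^ 2 :
      MvPolynomial (Fin 2) ℝ).totalDegree ≤ 2 :=
    (MvPolynomial.totalDegree_sub _ _).trans (by simp)
  have hsubst : ∀ i, (![2 * MvPolynomial.X 0 * MvPolynomial.X 1,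
      MvPolynomial.X 0 ^ 2 + MvPolynomial.X 1 ^ 2 - 1] i :
      MvPolynomial (Fin 2) ℝ).totalDegree ≤ 2 := by
    intro i
    fin_cases i
    · have h₂ : (2 * MvPolynomial.X 0 : MvPolynomial (Fin 2) ℝ).totalDegree ≤ 1 := by
        rw [two_mul]
        exact (MvPolynomial.totalDegree_add _ _).trans (by simp)
      refine (MvPolynomial.totalDegree_mul _ _).trans ?_
      rw [MvPolynomial.totalDegree_X]
      omega
    · refine (MvPolynomial.totalDegree_sub _ _).trans (max_le ?_ (by simp))
      exact (MvPolynomial.totalDegree_add _ _).trans (by simp)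
  obtain ⟨Q, hQdeg, hQ⟩ : ∃ Q : MvPolynomial (Fin 2) ℝ, Q.totalDegree ≤ 2*n ∧
      ∀ x₁ x₂ : ℝ, MvPolynomial.eval ![x₁, x₂] Q =
        (x₁ ^ 2 - x₂ ^ 2) * MvPolynomial.eval ![2 * x₁ * x₂, x₁ ^ 2 + x₂ ^ 2 - 1] P := by
    refine ⟨(MvPolynomial.X 0 ^ 2 - MvPolynomial.X 1 ^ 2) *
      MvPolynomial.bind₁ ![2 * MvPolynomial.X 0 * MvPolynomial.X 1,
        MvPolynomial.X 0 ^ 2 + MvPolynomial.X 1 ^ 2 - 1] P, ?_, fun x₁ x₂ => ?_⟩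
    · have := totalDegree_bind₁_le _ hsubst P
      exact (MvPolynomial.totalDegree_mul _ _).trans (by omega)
    · rw [map_mul, MvPolynomial.eval, MvPolynomial.eval₂Hom_bind₁]
      congr 1
      · simp
      · rw [MvPolynomial.eval]
        congr 2
        funext i
        fin_cases i <;> simp
  refine ⟨Q, hQdeg, hQ, fun h hh => ?_⟩
  obtain ⟨g, hgdeg, hg⟩ := exists_antisymm n h hh
  set F : ℝ × ℝ → ℝ := fun x =>
    MvPolynomial.eval ![x.1, x.2] Q * MvPolynomial.eval ![x.1, x.2] h * Wsq w γ x with hF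
  by_cases hint : IntegrableOn F (Icc (-1 : ℝ) 1 ×ˢ Icc (-1 : ℝ) 1)
  swap
  · exact integral_undef hint
  obtain ⟨hint', heq⟩ := setIntegral_fold measurePreserving_prodComm_volume (fun _ => rfl)
    measurableSet_lowerTriangle disjoint_lowerTriangle lowerTriangle_union_ae_eq_square hint
  obtain ⟨-, heq'⟩ := setIntegral_fold measurePreserving_antiSwap
    (fun x => by simp [antiSwap_apply]) measurableSet_rightTriangle disjoint_rightTriangle
    rightTriangle_union_ae_eq_lowerTriangle hint'
  have hzero := setIntegral_fold_eq_zero measurePreserving_prodComm_volume (fun _ => rfl)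
    measurableSet_lowerTriangle disjoint_lowerTriangle lowerTriangle_union_ae_eq_square
    (fun y => by
      change MvPolynomial.eval ![y.2 + y.1, y.2 * y.1] P *
          MvPolynomial.eval ![y.2 + y.1, y.2 * y.1] g *
          (w y.2 * w y.1 * ((1 - y.2 ^ 2) * (1 - y.1 ^ 2) * |y.2 - y.1| ^ (2*γ+1))) = _
      rw [add_comm y.2, mul_comm y.2, abs_sub_comm y.2]
      ring) (hPorth g hgdeg)
  have hsum : ∀ x : ℝ × ℝ,
      F x + F (MeasurableEquiv.prodComm x) +
        (F (antiSwap x) + F (MeasurableEquiv.prodComm (antiSwap x))) =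
      (x.1 ^ 2 - x.2 ^ 2) ^ 2 * MvPolynomial.eval ![2 * x.1 * x.2, x.1 ^ 2 + x.2 ^ 2 - 1] P *
        MvPolynomial.eval ![2 * x.1 * x.2, x.1 ^ 2 + x.2 ^ 2 - 1] g * Wsq w γ x := by
    rintro ⟨a, b⟩
    change F (a, b) + F (b, a) + (F (-b, -a) + F (-a, -b)) = _
    simp only [hF, hQ, Wsq_neg, Wsq_swap w γ a b, neg_sq]
    rw [show 2 * b * a = 2 * a * b by ring, show 2 * -b * -a = 2 * a * b by ring,
      show 2 * -a * -b = 2 * a * b by ring, add_comm (b ^ 2)]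
    linear_combination ((a ^ 2 - b ^ 2) *
      MvPolynomial.eval ![2 * a * b, a ^ 2 + b ^ 2 - 1] P * Wsq w γ (a, b)) * hg a b
  rw [setIntegral_lowerTriangle] at hzero
  rw [heq, heq', setIntegral_rightTriangle]
  simp only [hsum]
  rw [setIntegral_congr_fun measurableSet_angleTriangle fun t ht => by
    rw [density_identity w γ _ _ ht, eval_cosMap_eq_eval_cosSubAddMap,
      eval_cosMap_eq_eval_cosSubAddMap]]
  rw [integral_const_mul, hzero, mul_zero]

end
end

section
/- Write the Gauss nodes as t_k = cos θ_k with θ_k ∈ (0,π), and set s_{j,k} = cos((θ_j−θ_k)/2) and τ_{j,k} = cos((θ_j+θ_k)/2). Then for every real polynomial f in two variables of total degree ≤ 4m−1, ∫_{[-1,1]²} f(x₁,x₂) W_{1/2}(x₁,x₂) dx₁dx₂ = (1/8) Σ_{1 ≤ j < k ≤ m+1} λ_j λ_k (cos θ_j − cos θ_k)² [ f(s_{j,k}, τ_{j,k}) + f(τ_{j,k}, s_{j,k}) + f(−s_{j,k}, −τ_{j,k}) + f(−τ_{j,k}, −s_{j,k}) ]. Moreover the nodes appearing on the right-hand side are 2m(m+1)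 distinct points, so this cubature rule of degree 4m−1 attains Möller's lower bound dim Π²_{2m-1} + m = 2m(m+1). -/
open MeasureTheory Set

noncomputable section

/-- The weight `W_{1/2}` on the square `[-1,1]²`, with `θᵢ = arccos xᵢ`. -/
def Wp (w : ℝ → ℝ) (x : ℝ × ℝ) : ℝ :=
  w (Real.cos (Real.arccos x.1 - Real.arccos x.2)) *
  w (Real.cos (Real.arccos x.1 + Real.arccos x.2)) *
  Real.sqrt (1 - x.1 ^ 2) * Real.sqrt (1 - x.2 ^ 2) * |x.1 ^ 2 - x.2 ^ 2|

theorem mem_restrictDegree_iff_degreeOf_le {σ R : Type*} [CommRing R] {n : ℕ}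
    {p : MvPolynomial σ R} :
    p ∈ MvPolynomial.restrictDegree σ R n ↔ ∀ i, MvPolynomial.degreeOf i p ≤ n := by
  simp only [MvPolynomial.mem_restrictDegree, MvPolynomial.degreeOf_le_iff]
  exact ⟨fun h i d hd => h d hd i, fun h d hd i => h i d hd⟩

theorem mul_mem_restrictDegree {σ R : Type*} [CommRing R] {a b : ℕ} {p q : MvPolynomial σ R}
    (hp : p ∈ MvPolynomial.restrictDegree σ R a) (hq : q ∈ MvPolynomial.restrictDegree σ R b) :
    p * q ∈ MvPolynomial.restrictDegree σ R (a + b) := by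
  rw [mem_restrictDegree_iff_degreeOf_le] at *
  exact fun i => (MvPolynomial.degreeOf_mul_le i p q).trans (add_le_add (hp i) (hq i))

theorem restrictDegree_mono {σ R : Type*} [CommRing R] {a b : ℕ} (h : a ≤ b) :
    MvPolynomial.restrictDegree σ R a ≤ MvPolynomial.restrictDegree σ R b := by
  intro p hp
  rw [MvPolynomial.mem_restrictDegree] at *
  exact fun s hs i => (hp s hs i).trans h

theorem C_mem_restrictDegree {σ R : Type*} [CommRing R] (a : ℕ) (c : R) :
    MvPolynomial.C c ∈ MvPolynomial.restrictDegree σ R a := by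
  simp [mem_restrictDegree_iff_degreeOf_le, MvPolynomial.degreeOf_C]

theorem X_mem_restrictDegree {σ R : Type*} [CommRing R] [Nontrivial R] (i : σ) :
    (MvPolynomial.X i : MvPolynomial σ R) ∈ MvPolynomial.restrictDegree σ R 1 := by
  classical
  rw [mem_restrictDegree_iff_degreeOf_le]
  intro j
  rw [MvPolynomial.degreeOf_X]
  split_ifs <;> simp

theorem half_add_mem_restrictDegree :
    (MvPolynomial.C (1/2) * (MvPolynomial.X 0 + MvPolynomial.X 1) : MvPolynomial (Fin 2) ℝ) ∈
      MvPolynomial.restrictDegree (Fin 2) ℝ 1 := by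
  rw [← MvPolynomial.smul_eq_C_mul]
  exact Submodule.smul_mem _ _
    (Submodule.add_mem _ (X_mem_restrictDegree 0) (X_mem_restrictDegree 1))

theorem mul_add_one_mem_restrictDegree :
    (MvPolynomial.X 0 * MvPolynomial.X 1 + 1 : MvPolynomial (Fin 2) ℝ) ∈
      MvPolynomial.restrictDegree (Fin 2) ℝ 1 := by
  refine Submodule.add_mem _ ?_ (by simpa using C_mem_restrictDegree (σ := Fin 2) 1 (1 : ℝ))
  rw [mem_restrictDegree_iff_degreeOf_le]
  intro j
  refine (MvPolynomial.degreeOf_mul_le j _ _).trans ?_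
  rw [MvPolynomial.degreeOf_X, MvPolynomial.degreeOf_X]
  fin_cases j <;> simp

/-- Even power sums of `x, y` are polynomials in `u, v`, where `x = cos α`, `y = cos β`,
`u = cos (α - β)`, `v = cos (α + β)`. -/
theorem exists_powerSum (n : ℕ) : ∃ G ∈ MvPolynomial.restrictDegree (Fin 2) ℝ n,
    ∀ x y u v : ℝ, u + v = 2 * (x * y) → u * v = x ^ 2 + y ^ 2 - 1 →
      x ^ (2 * n) + y ^ (2 * n) = MvPolynomial.eval ![u, v] G := by
  induction n using Nat.twoStepInduction with
  | zero =>
    refine ⟨MvPolynomial.C 2, C_mem_restrictDegree _ _, fun x y u v _ _ => ?_⟩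
    simp; norm_num
  | one =>
    refine ⟨_, mul_add_one_mem_restrictDegree, fun x y u v _ h => ?_⟩
    simp [h]
  | more n ih1 ih2 =>
    obtain ⟨P, hP, hP'⟩ := ih1
    obtain ⟨Q, hQ, hQ'⟩ := ih2
    have h1 := mul_mem_restrictDegree hQ mul_add_one_mem_restrictDegree
    have h2 := mul_mem_restrictDegree hP
      (mul_mem_restrictDegree half_add_mem_restrictDegree half_add_mem_restrictDegree)
    refine ⟨_, Submodule.sub_mem _ h1 h2, fun x y u v h1 h2 => ?_⟩
    have e1 := hP' x y u v h1 h2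
    have e2 := hQ' x y u v h1 h2
    simp only [map_sub, map_mul, map_add, MvPolynomial.eval_X, MvPolynomial.eval_C, map_one,
      Matrix.cons_val_zero, Matrix.cons_val_one, ← e1, ← e2, h1, h2]
    ring

theorem exists_orbitSum_monomial {m : ℕ} (hm : 1 ≤ m) {i j : ℕ} (hij : i + j ≤ 4 * m - 1) :
    ∃ G ∈ MvPolynomial.restrictDegree (Fin 2) ℝ (2 * m - 1),
    ∀ x y u v : ℝ, u + v = 2 * (x * y) → u * v = x ^ 2 + y ^ 2 - 1 →
      x ^ i * y ^ j + y ^ i * x ^ j + (-x) ^ i * (-y) ^ j + (-y) ^ i * (-x) ^ j =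
        MvPolynomial.eval ![u, v] G := by
  wlog hle : i ≤ j generalizing i j
  · obtain ⟨G, hG, h⟩ := this (i := j) (j := i) (by omega) (by omega)
    exact ⟨G, hG, fun x y u v h1 h2 => by rw [← h x y u v h1 h2]; ring⟩
  rcases Nat.even_or_odd (i + j) with he | ho
  · obtain ⟨n, rfl⟩ : ∃ n, j = i + 2 * n := by
      obtain ⟨k, hk⟩ := he
      exact ⟨k - i, by omega⟩
    obtain ⟨P, hP, hP'⟩ := exists_powerSum n
    have hpow : ∀ k : ℕ, (MvPolynomial.C (1/2) * (MvPolynomial.X 0 + MvPolynomial.X 1) :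
        MvPolynomial (Fin 2) ℝ) ^ k ∈ MvPolynomial.restrictDegree (Fin 2) ℝ k := by
      intro k
      induction k with
      | zero => simpa using C_mem_restrictDegree (σ := Fin 2) 0 (1 : ℝ)
      | succ k ih => rw [pow_succ]; exact mul_mem_restrictDegree ih half_add_mem_restrictDegree
    refine ⟨(2 : ℝ) • (_ ^ i * P), Submodule.smul_mem _ _ (restrictDegree_mono (by omega)
      (mul_mem_restrictDegree (hpow i) hP)), fun x y u v h1 h2 => ?_⟩
    have hs : ∀ a b : ℝ, (-a) ^ i * (-b) ^ (i + 2 * n) = a ^ i * b ^ (i + 2 * n) := by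
      intro a b
      rw [neg_pow a, neg_pow b, mul_mul_mul_comm, ← pow_add, he.neg_one_pow, one_mul]
    simp only [MvPolynomial.smul_eval, map_mul, map_pow, map_add, MvPolynomial.eval_X,
      MvPolynomial.eval_C, Matrix.cons_val_zero, Matrix.cons_val_one, ← hP' x y u v h1 h2, h1, hs]
    ring
  · refine ⟨0, Submodule.zero_mem _, fun x y u v _ _ => ?_⟩
    have hs : ∀ a b : ℝ, (-a) ^ i * (-b) ^ j = -(a ^ i * b ^ j) := by
      intro a b
      rw [neg_pow a, neg_pow b, mul_mul_mul_comm, ← pow_add, ho.neg_one_pow, neg_one_mul]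
    rw [hs, hs, map_zero]
    ring

theorem exists_orbitSum {m : ℕ} (hm : 1 ≤ m) (f : MvPolynomial (Fin 2) ℝ)
    (hf : f.totalDegree ≤ 4 * m - 1) :
    ∃ G ∈ MvPolynomial.restrictDegree (Fin 2) ℝ (2 * m - 1),
    ∀ x y u v : ℝ, u + v = 2 * (x * y) → u * v = x ^ 2 + y ^ 2 - 1 →
      MvPolynomial.eval ![x, y] f + MvPolynomial.eval ![y, x] f +
        MvPolynomial.eval ![-x, -y] f + MvPolynomial.eval ![-y, -x] f =
        MvPolynomial.eval ![u, v] G := by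
  have key : ∀ d : f.support, d.1 0 + d.1 1 ≤ 4 * m - 1 := fun d => by
    have := MvPolynomial.le_totalDegree d.2
    rw [Finsupp.sum_fintype _ _ (by simp), Fin.sum_univ_two] at this
    omega
  choose G hG hG' using fun d => exists_orbitSum_monomial hm (key d)
  refine ⟨∑ d ∈ f.support.attach, f.coeff d.1 • G d,
    Submodule.sum_mem _ fun d _ => Submodule.smul_mem _ _ (hG d), fun x y u v h1 h2 => ?_⟩
  rw [map_sum]
  simp only [MvPolynomial.eval_eq' _ f, Fin.prod_univ_two, Matrix.cons_val_zero,
    Matrix.cons_val_one, ← Finset.sum_add_distrib, ← mul_add]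
  rw [← Finset.sum_attach]
  exact Finset.sum_congr rfl fun d _ => by
    rw [hG' d x y u v h1 h2, MvPolynomial.smul_eval]

/-- The tensor product of a quadrature rule of degree `n` with itself is exact on polynomials of
degree at most `n` in each variable. -/
theorem setIntegral_prod_eq_sum {ι : Type*} [Fintype ι] {n : ℕ} {w : ℝ → ℝ} {S : Set ℝ}
    (hS : IsCompact S) (hw : IntegrableOn w S) (t lam : ι → ℝ)
    (hquad : ∀ g : Polynomial ℝ, g.natDegree ≤ n →
      (∫ u in S, g.eval u * w u) = ∑ k, lam k * g.eval (t k))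
    {H : MvPolynomial (Fin 2) ℝ} (hH : H ∈ MvPolynomial.restrictDegree (Fin 2) ℝ n) :
    ∫ p in S ×ˢ S, MvPolynomial.eval ![p.1, p.2] H * (w p.1 * w p.2) =
      ∑ j, ∑ k, lam j * lam k * MvPolynomial.eval ![t j, t k] H := by
  rw [MvPolynomial.mem_restrictDegree] at hH
  have hmono : ∀ a ≤ n, (∫ u in S, u ^ a * w u) = ∑ k, lam k * t k ^ a := fun a ha => by
    simpa using hquad (Polynomial.X ^ a) (by simpa using ha)
  have hint : ∀ a : ℕ, IntegrableOn (fun u => u ^ a * w u) S := fun a =>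
    hw.continuousOn_mul (by fun_prop) hS
  simp only [MvPolynomial.eval_eq', Fin.prod_univ_two, Matrix.cons_val_zero, Matrix.cons_val_one,
    Finset.sum_mul, Finset.mul_sum]
  rw [integral_finsetSum]
  · rw [Finset.sum_congr rfl fun j _ => Finset.sum_comm, Finset.sum_comm]
    refine Finset.sum_congr rfl fun d hd => ?_
    calc _ = ∫ p in S ×ˢ S, MvPolynomial.coeff d H * ((p.1 ^ d 0 * w p.1) * (p.2 ^ d 1 * w p.2)) :=
          integral_congr_ae (.of_forall fun p => by ring)
      _ = _ := by
          rw [integral_const_mul, Measure.volume_eq_prod,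
            setIntegral_prod_mul (fun u => u ^ d 0 * w u) (fun u => u ^ d 1 * w u),
            hmono _ (hH d hd 0), hmono _ (hH d hd 1), Finset.sum_mul_sum, Finset.mul_sum]
          refine Finset.sum_congr rfl fun j _ => ?_
          rw [Finset.mul_sum]
          exact Finset.sum_congr rfl fun k _ => by ring
  · intro d _
    have h := (Integrable.mul_prod (hint (d 0)) (hint (d 1))).const_mul (MvPolynomial.coeff d H)
    rw [Measure.prod_restrict, ← Measure.volume_eq_prod] at h
    exact h.congr (.of_forall fun p => by ring)

theorem sum_sum_eq_two_mul_sum_lt {n : ℕ} {R : Type*} [CommRing R] (A : Fin n → Fin n → R)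
    (hsymm : ∀ j k, A j k = A k j) (hdiag : ∀ j, A j j = 0) :
    ∑ j, ∑ k, A j k =
      2 * ∑ q ∈ Finset.univ.filter (fun q : Fin n × Fin n => q.1 < q.2), A q.1 q.2 := by
  rw [← Fintype.sum_prod_type', two_mul]
  have h1 : ∑ q ∈ Finset.univ.filter (fun q : Fin n × Fin n => q.1 < q.2), A q.1 q.2 =
      ∑ q ∈ Finset.univ.filter (fun q : Fin n × Fin n => q.2 < q.1), A q.1 q.2 :=
    Finset.sum_nbij' Prod.swap Prod.swap (by simp) (by simp) (by simp) (by simp)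
      (fun q _ => hsymm _ _)
  conv_rhs => arg 2; rw [h1]
  rw [Finset.sum_filter, Finset.sum_filter, ← Finset.sum_add_distrib]
  refine Finset.sum_congr rfl fun ⟨j, k⟩ _ => ?_
  rcases lt_trichotomy j k with h | rfl | h
  · simp [h, h.not_gt]
  · simp [hdiag]
  · simp [h, h.not_gt]

theorem card_filter_fst_lt_snd (m : ℕ) :
    4 * (Finset.univ.filter (fun q : Fin (m + 1) × Fin (m + 1) => q.1 < q.2)).card =
      2 * m * (m + 1) := by
  have h := sum_sum_eq_two_mul_sum_lt (n := m + 1) (R := ℤ) (fun j k => if j = k then 0 else 1)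
    (by simp [eq_comm]) (by simp)
  have h2 : ∑ q ∈ Finset.univ.filter (fun q : Fin (m + 1) × Fin (m + 1) => q.1 < q.2),
      (if q.1 = q.2 then (0:ℤ) else 1) =
      (Finset.univ.filter (fun q : Fin (m + 1) × Fin (m + 1) => q.1 < q.2)).card := by
    rw [Finset.card_eq_sum_ones, Nat.cast_sum]
    exact Finset.sum_congr rfl fun q hq => by simp [(Finset.mem_filter.1 hq).2.ne]
  rw [h2] at h
  have h3 : ∀ j : Fin (m + 1), ∑ k, (if j = k then (0:ℤ) else 1) = m := fun j => by
    have e : ∀ k, (if j = k then (0:ℤ) else 1) = 1 - if j = k then 1 else 0 := fun k => by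
      split_ifs <;> rfl
    simp [e]
  simp only [h3] at h
  simp at h
  zify
  linarith

/-- The open triangle `-1 < v < u < 1`. -/
def openTriangle : Set (ℝ × ℝ) := {p | -1 < p.2 ∧ p.2 < p.1 ∧ p.1 < 1}

/-- The part of the open square where `x + y` has the sign of `ε` and `x - y` the sign of `δ`. -/
def squareSector (ε δ : ℝ) : Set (ℝ × ℝ) :=
  {x | x.1 ^ 2 < 1 ∧ x.2 ^ 2 < 1 ∧ 0 < ε * (x.1 + x.2) ∧ 0 < δ * (x.1 - x.2)}

/-- The four branches of the inverse of `(cos α, cos β) ↦ (cos (α - β), cos (α + β))`. -/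
def branch (ε δ : ℝ) (p : ℝ × ℝ) : ℝ × ℝ :=
  ((ε * √((1 + p.1) * (1 + p.2)) + δ * √((1 - p.1) * (1 - p.2))) / 2,
   (ε * √((1 + p.1) * (1 + p.2)) - δ * √((1 - p.1) * (1 - p.2))) / 2)

theorem abs_eq_one_of_sq {a : ℝ} (h : a ^ 2 = 1) : |a| = 1 :=
  (abs_eq zero_le_one).2 (sq_eq_one_iff.1 h)

theorem measurableSet_openTriangle : MeasurableSet openTriangle :=
  ((isOpen_lt continuous_const continuous_snd).inter
    ((isOpen_lt continuous_snd continuous_fst).inter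
      (isOpen_lt continuous_fst continuous_const))).measurableSet

theorem measurableSet_squareSector (ε δ : ℝ) : MeasurableSet (squareSector ε δ) := by
  unfold squareSector
  measurability

theorem continuous_branch (ε δ : ℝ) : Continuous (branch ε δ) := by
  unfold branch; fun_prop

theorem branch_swap (ε δ : ℝ) (p : ℝ × ℝ) : branch ε δ p.swap = branch ε δ p := by
  simp [branch, mul_comm]

theorem openTriangle_subset : openTriangle ⊆ Icc (-1:ℝ) 1 ×ˢ Icc (-1:ℝ) 1 :=
  fun p ⟨h1, h2, h3⟩ => ⟨⟨by linarith, by linarith⟩, ⟨by linarith, by linarith⟩⟩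

section branch

variable {ε δ : ℝ} {p : ℝ × ℝ}

theorem branch_mul (hε : ε ^ 2 = 1) (hδ : δ ^ 2 = 1)
    (hp : p ∈ Icc (-1:ℝ) 1 ×ˢ Icc (-1:ℝ) 1) :
    p.1 + p.2 = 2 * ((branch ε δ p).1 * (branch ε δ p).2) := by
  obtain ⟨⟨h1, h2⟩, h3, h4⟩ := hp
  have ha := Real.sq_sqrt (mul_nonneg (by linarith : 0 ≤ 1 + p.1) (by linarith : 0 ≤ 1 + p.2))
  have hb := Real.sq_sqrt (mul_nonneg (by linarith : 0 ≤ 1 - p.1) (by linarith : 0 ≤ 1 - p.2))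
  simp only [branch]
  linear_combination (-ε ^ 2 / 2) * ha + (δ ^ 2 / 2) * hb -
    (1 + p.1) * (1 + p.2) / 2 * hε + (1 - p.1) * (1 - p.2) / 2 * hδ

theorem branch_sq_add_sq (hε : ε ^ 2 = 1) (hδ : δ ^ 2 = 1)
    (hp : p ∈ Icc (-1:ℝ) 1 ×ˢ Icc (-1:ℝ) 1) :
    p.1 * p.2 = (branch ε δ p).1 ^ 2 + (branch ε δ p).2 ^ 2 - 1 := by
  obtain ⟨⟨h1, h2⟩, h3, h4⟩ := hp
  have ha := Real.sq_sqrt (mul_nonneg (by linarith : 0 ≤ 1 + p.1) (by linarith : 0 ≤ 1 + p.2))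
  have hb := Real.sq_sqrt (mul_nonneg (by linarith : 0 ≤ 1 - p.1) (by linarith : 0 ≤ 1 - p.2))
  simp only [branch]
  linear_combination (-ε ^ 2 / 2) * ha - (δ ^ 2 / 2) * hb -
    (1 + p.1) * (1 + p.2) / 2 * hε - (1 - p.1) * (1 - p.2) / 2 * hδ

theorem branch_mem_squareSector (hε : ε ^ 2 = 1) (hδ : δ ^ 2 = 1) (hp : p ∈ openTriangle) :
    branch ε δ p ∈ squareSector ε δ := by
  have e1 := branch_mul hε hδ (openTriangle_subset hp)
  have e2 := branch_sq_add_sq hε hδ (openTriangle_subset hp)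
  obtain ⟨h1, h2, h3⟩ := hp
  have ha := Real.sqrt_pos.2 (mul_pos (by linarith : 0 < 1 + p.1) (by linarith : 0 < 1 + p.2))
  have hb := Real.sqrt_pos.2 (mul_pos (by linarith : 0 < 1 - p.1) (by linarith : 0 < 1 - p.2))
  have hs : 0 < ε * ((branch ε δ p).1 + (branch ε δ p).2) := by
    convert ha using 1
    simp only [branch]
    linear_combination √((1 + p.1) * (1 + p.2)) * hε
  have hd : 0 < δ * ((branch ε δ p).1 - (branch ε δ p).2) := by
    convert hb using 1
    simp only [branch]
    linear_combination √((1 - p.1) * (1 - p.2)) * hδ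
  set x := branch ε δ p
  have hprod : 0 < (1 - x.1 ^ 2) * (1 - x.2 ^ 2) := by nlinarith [sq_pos_of_pos (sub_pos.2 h2)]
  have hsum : x.1 ^ 2 + x.2 ^ 2 < 2 := by nlinarith
  have : x.1 ^ 2 < 1 ∧ x.2 ^ 2 < 1 := by
    rcases pos_and_pos_or_neg_and_neg_of_mul_pos hprod with ⟨h, h'⟩ | ⟨h, h'⟩
    · exact ⟨by linarith, by linarith⟩
    · linarith
  exact ⟨this.1, this.2, hs, hd⟩

theorem sqrt_mul_sqrt_branch (hε : ε ^ 2 = 1) (hδ : δ ^ 2 = 1) (hp : p ∈ openTriangle) :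
    √(1 - (branch ε δ p).1 ^ 2) * √(1 - (branch ε δ p).2 ^ 2) = (p.1 - p.2) / 2 := by
  have e1 := branch_mul hε hδ (openTriangle_subset hp)
  have e2 := branch_sq_add_sq hε hδ (openTriangle_subset hp)
  obtain ⟨h1, h2, -, -⟩ := branch_mem_squareSector hε hδ hp
  rw [← Real.sqrt_mul (by linarith), Real.sqrt_eq_iff_mul_self_eq]
  · linear_combination
      e2 - ((branch ε δ p).1 * (branch ε δ p).2 + (p.1 + p.2) / 2) * (1 / 2) * e1
  · nlinarith
  · linarith [hp.2.1]

theorem Wp_branch (w : ℝ → ℝ) (hε : ε ^ 2 = 1) (hδ : δ ^ 2 = 1) (hp : p ∈ openTriangle) :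
    Wp w (branch ε δ p) = w p.1 * w p.2 * ((p.1 - p.2) / 2) *
      (√((1 + p.1) * (1 + p.2)) * √((1 - p.1) * (1 - p.2))) := by
  have e1 := branch_mul hε hδ (openTriangle_subset hp)
  have e3 := sqrt_mul_sqrt_branch hε hδ hp
  obtain ⟨h1, h2, -, -⟩ := branch_mem_squareSector hε hδ hp
  have habs : |(branch ε δ p).1 ^ 2 - (branch ε δ p).2 ^ 2| =
      √((1 + p.1) * (1 + p.2)) * √((1 - p.1) * (1 - p.2)) := by
    have : (branch ε δ p).1 ^ 2 - (branch ε δ p).2 ^ 2 =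
      (ε * δ) * (√((1 + p.1) * (1 + p.2)) * √((1 - p.1) * (1 - p.2))) := by
      simp only [branch]; ring
    rw [this, abs_mul, abs_of_nonneg (mul_nonneg (Real.sqrt_nonneg _) (Real.sqrt_nonneg _)),
      abs_mul, abs_eq_one_of_sq hε, abs_eq_one_of_sq hδ]
    ring
  obtain ⟨h1a, h1b⟩ := abs_le.1 ((sq_lt_one_iff_abs_lt_one _).1 h1).le
  obtain ⟨h2a, h2b⟩ := abs_le.1 ((sq_lt_one_iff_abs_lt_one _).1 h2).le
  rw [Wp, Real.cos_sub, Real.cos_add, Real.cos_arccos h1a h1b, Real.cos_arccos h2a h2b,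
    Real.sin_arccos, Real.sin_arccos, habs, mul_assoc (w _ * w _), e3]
  congr 4 <;> linarith

theorem image_branch (hε : ε ^ 2 = 1) (hδ : δ ^ 2 = 1) :
    branch ε δ '' openTriangle = squareSector ε δ := by
  refine subset_antisymm (image_subset_iff.2 fun p hp => branch_mem_squareSector hε hδ hp) ?_
  rintro ⟨x, y⟩ ⟨hx, hy, hs, hd⟩
  simp only at hx hy hs hd
  have hr : 0 < √((1 - x ^ 2) * (1 - y ^ 2)) :=
    Real.sqrt_pos.2 (mul_pos (by linarith) (by linarith))
  have hr2 := Real.sq_sqrt (mul_pos (by linarith : 0 < 1 - x ^ 2) (by linarith : 0 < 1 - y ^ 2)).le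
  set r := √((1 - x ^ 2) * (1 - y ^ 2))
  have ea : (1 + (x * y + r)) * (1 + (x * y - r)) = (ε * (x + y)) ^ 2 := by
    linear_combination -hr2 - (x + y) ^ 2 * hε
  have eb : (1 - (x * y + r)) * (1 - (x * y - r)) = (δ * (x - y)) ^ 2 := by
    linear_combination -hr2 - (x - y) ^ 2 * hδ
  have hxy : (x * y) ^ 2 < 1 := by nlinarith [sq_nonneg x, sq_nonneg y]
  obtain ⟨hxy1, hxy2⟩ := abs_lt.1 ((sq_lt_one_iff_abs_lt_one _).1 hxy)
  have pa : 0 < (1 + (x * y + r)) * (1 + (x * y - r)) := by rw [ea]; positivity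
  have pb : 0 < (1 - (x * y + r)) * (1 - (x * y - r)) := by rw [eb]; positivity
  refine ⟨(x * y + r, x * y - r), ⟨?_, ?_, ?_⟩, ?_⟩
  · have := pos_of_mul_pos_right pa (by linarith)
    simp only; linarith
  · simp only; linarith
  · have := pos_of_mul_pos_left pb (by linarith)
    simp only; linarith
  · simp only [branch, ea, eb, Real.sqrt_sq hs.le, Real.sqrt_sq hd.le]
    refine Prod.ext ?_ ?_ <;> simp only
    · linear_combination (x + y) / 2 * hε + (x - y) / 2 * hδ
    · linear_combination (x + y) / 2 * hε - (x - y) / 2 * hδ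

theorem injOn_branch (hε : ε ^ 2 = 1) (hδ : δ ^ 2 = 1) : InjOn (branch ε δ) openTriangle := by
  intro p hp q hq h
  have e1 := branch_mul hε hδ (openTriangle_subset hp)
  have e2 := branch_sq_add_sq hε hδ (openTriangle_subset hp)
  rw [h] at e1 e2
  rw [← branch_mul hε hδ (openTriangle_subset hq)] at e1
  rw [← branch_sq_add_sq hε hδ (openTriangle_subset hq)] at e2
  have hp2 := hp.2.1
  have hq2 := hq.2.1
  have h0 : (p.1 - q.1) * (p.1 - q.2) = 0 := by linear_combination p.1 * e1 - e2
  rcases mul_eq_zero.1 h0 with h0 | h0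
  · exact Prod.ext (by linarith) (by linarith)
  · linarith

/-- The derivative of `branch ε δ`. -/
def fderivBranch (ε δ : ℝ) (p : ℝ × ℝ) : ℝ × ℝ →L[ℝ] ℝ × ℝ :=
  (Matrix.toLin (.finTwoProd ℝ) (.finTwoProd ℝ)
    !![(ε * ((1 + p.2) / (2 * √((1 + p.1) * (1 + p.2)))) -
          δ * ((1 - p.2) / (2 * √((1 - p.1) * (1 - p.2))))) / 2,
        (ε * ((1 + p.1) / (2 * √((1 + p.1) * (1 + p.2)))) -
          δ * ((1 - p.1) / (2 * √((1 - p.1) * (1 - p.2))))) / 2;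
       (ε * ((1 + p.2) / (2 * √((1 + p.1) * (1 + p.2)))) +
          δ * ((1 - p.2) / (2 * √((1 - p.1) * (1 - p.2))))) / 2,
        (ε * ((1 + p.1) / (2 * √((1 + p.1) * (1 + p.2)))) +
          δ * ((1 - p.1) / (2 * √((1 - p.1) * (1 - p.2))))) / 2]).toContinuousLinearMap

theorem hasFDerivAt_branch (ε δ : ℝ) (hp : p ∈ openTriangle) :
    HasFDerivAt (branch ε δ) (fderivBranch ε δ p) p := by
  obtain ⟨h1, h2, h3⟩ := hp
  have pa := mul_pos (by linarith : 0 < 1 + p.1) (by linarith : 0 < 1 + p.2)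
  have pb := mul_pos (by linarith : 0 < 1 - p.1) (by linarith : 0 < 1 - p.2)
  have f1 : HasFDerivAt (fun q : ℝ × ℝ => q.1) (ContinuousLinearMap.fst ℝ ℝ ℝ) p := hasFDerivAt_fst
  have f2 : HasFDerivAt (fun q : ℝ × ℝ => q.2) (ContinuousLinearMap.snd ℝ ℝ ℝ) p := hasFDerivAt_snd
  have ha := (((f1.const_add 1).mul (f2.const_add 1)).sqrt pa.ne').const_mul ε
  have hb := (((f1.const_sub 1).mul (f2.const_sub 1)).sqrt pb.ne').const_mul δ
  have hx := ((ha.add hb).mul_const (1/2)).prodMk ((ha.sub hb).mul_const (1/2))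
  unfold fderivBranch
  rw [Matrix.toLin_finTwoProd_toContinuousLinearMap]
  refine (hx.congr_fderiv ?_).congr_of_eventuallyEq (.of_forall fun q => ?_)
  · ext <;> simp <;> ring
  · simp [branch, div_eq_mul_inv]

theorem abs_det_fderivBranch (hε : ε ^ 2 = 1) (hδ : δ ^ 2 = 1) (hp : p ∈ openTriangle) :
    |(fderivBranch ε δ p).det| =
      (p.1 - p.2) / (4 * (√((1 + p.1) * (1 + p.2)) * √((1 - p.1) * (1 - p.2)))) := by
  obtain ⟨h1, h2, h3⟩ := hp
  have ha := Real.sqrt_pos.2 (mul_pos (by linarith : 0 < 1 + p.1) (by linarith : 0 < 1 + p.2))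
  have hb := Real.sqrt_pos.2 (mul_pos (by linarith : 0 < 1 - p.1) (by linarith : 0 < 1 - p.2))
  have hdet : (fderivBranch ε δ p).det = -(ε * δ) *
      ((p.1 - p.2) / (4 * (√((1 + p.1) * (1 + p.2)) * √((1 - p.1) * (1 - p.2))))) := by
    unfold fderivBranch
    simp only [LinearMap.det_toContinuousLinearMap, LinearMap.det_toLin, Matrix.det_fin_two_of]
    field_simp
    ring
  have hnn : 0 ≤ (p.1 - p.2) / (4 * (√((1 + p.1) * (1 + p.2)) * √((1 - p.1) * (1 - p.2)))) :=
    div_nonneg (by linarith) (by positivity)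
  rw [hdet, abs_mul, abs_of_nonneg hnn, abs_neg, abs_mul, abs_eq_one_of_sq hε,
    abs_eq_one_of_sq hδ]
  ring

theorem abs_det_smul_branch (w : ℝ → ℝ) (F : ℝ × ℝ → ℝ) (hε : ε ^ 2 = 1) (hδ : δ ^ 2 = 1)
    (hp : p ∈ openTriangle) :
    |(fderivBranch ε δ p).det| • (F (branch ε δ p) * Wp w (branch ε δ p)) =
      1 / 8 * (F (branch ε δ p) * (p.1 - p.2) ^ 2 * (w p.1 * w p.2)) := by
  rw [abs_det_fderivBranch hε hδ hp, Wp_branch w hε hδ hp]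
  obtain ⟨h1, h2, h3⟩ := hp
  have ha := Real.sqrt_pos.2 (mul_pos (by linarith : 0 < 1 + p.1) (by linarith : 0 < 1 + p.2))
  have hb := Real.sqrt_pos.2 (mul_pos (by linarith : 0 < 1 - p.1) (by linarith : 0 < 1 - p.2))
  rw [smul_eq_mul]
  field_simp
  ring

theorem setIntegral_squareSector (w : ℝ → ℝ) (F : ℝ × ℝ → ℝ) (hε : ε ^ 2 = 1)
    (hδ : δ ^ 2 = 1) :
    ∫ x in squareSector ε δ, F x * Wp w x =
      ∫ p in openTriangle, 1 / 8 * (F (branch ε δ p) * (p.1 - p.2) ^ 2 * (w p.1 * w p.2)) := by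
  rw [← image_branch hε hδ, integral_image_eq_integral_abs_det_fderiv_smul volume
    measurableSet_openTriangle (fun p hp => (hasFDerivAt_branch ε δ hp).hasFDerivWithinAt)
    (injOn_branch hε hδ)]
  exact setIntegral_congr_fun measurableSet_openTriangle fun p hp =>
    abs_det_smul_branch w F hε hδ hp

theorem integrableOn_branch {w : ℝ → ℝ} (hw : IntegrableOn w (Icc (-1:ℝ) 1)) {F : ℝ × ℝ → ℝ}
    (hF : Continuous F) (ε δ : ℝ) :
    IntegrableOn (fun p : ℝ × ℝ => 1 / 8 * (F (branch ε δ p) * (p.1 - p.2) ^ 2 * (w p.1 * w p.2)))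
      (Icc (-1:ℝ) 1 ×ˢ Icc (-1:ℝ) 1) := by
  have h := Integrable.mul_prod hw hw
  rw [Measure.prod_restrict, ← Measure.volume_eq_prod] at h
  have hc : Continuous fun p : ℝ × ℝ => F (branch ε δ p) * (p.1 - p.2) ^ 2 :=
    (hF.comp (continuous_branch ε δ)).mul (by fun_prop)
  exact (IntegrableOn.continuousOn_mul hc.continuousOn h
    (isCompact_Icc.prod isCompact_Icc)).const_mul _

theorem integrableOn_squareSector {w : ℝ → ℝ} (hw : IntegrableOn w (Icc (-1:ℝ) 1))
    {F : ℝ × ℝ → ℝ} (hF : Continuous F) (hε : ε ^ 2 = 1) (hδ : δ ^ 2 = 1) :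
    IntegrableOn (fun x => F x * Wp w x) (squareSector ε δ) := by
  rw [← image_branch hε hδ, integrableOn_image_iff_integrableOn_abs_det_fderiv_smul volume
    measurableSet_openTriangle (fun p hp => (hasFDerivAt_branch ε δ hp).hasFDerivWithinAt)
    (injOn_branch hε hδ)]
  exact ((integrableOn_branch hw hF ε δ).mono_set openTriangle_subset).congr_fun
    (fun p hp => (abs_det_smul_branch w F hε hδ hp).symm) measurableSet_openTriangle

end branch

theorem disjoint_squareSector_left {ε δ δ' : ℝ} :
    Disjoint (squareSector ε δ) (squareSector (-ε) δ') :=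
  Set.disjoint_left.2 fun x ⟨_, _, h, _⟩ ⟨_, _, h', _⟩ => by linarith

theorem disjoint_squareSector_right {ε ε' δ : ℝ} :
    Disjoint (squareSector ε δ) (squareSector ε' (-δ)) :=
  Set.disjoint_left.2 fun x ⟨_, _, _, h⟩ ⟨_, _, _, h'⟩ => by linarith

theorem Wp_eq_zero {w : ℝ → ℝ} {x : ℝ × ℝ} (hx : x ∈ Icc (-1:ℝ) 1 ×ˢ Icc (-1:ℝ) 1)
    (hx' : x ∉ (squareSector 1 1 ∪ squareSector 1 (-1)) ∪
      (squareSector (-1) 1 ∪ squareSector (-1) (-1))) : Wp w x = 0 := by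
  obtain ⟨⟨h1, h2⟩, h3, h4⟩ := hx
  have k1 : x.1 ^ 2 ≤ 1 := by nlinarith
  have k2 : x.2 ^ 2 ≤ 1 := by nlinarith
  rcases k1.eq_or_lt with h | k1
  · simp [Wp, h]
  rcases k2.eq_or_lt with h | k2
  · simp [Wp, h]
  rcases eq_or_ne (x.1 + x.2) 0 with h | hs
  · simp [Wp, sq_sub_sq, h]
  rcases eq_or_ne (x.1 - x.2) 0 with h | hd
  · simp [Wp, sq_sub_sq, h]
  refine absurd ?_ hx'
  rcases hs.lt_or_gt with hs | hs <;> rcases hd.lt_or_gt with hd | hd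
  · exact Or.inr (Or.inr ⟨k1, k2, by linarith, by linarith⟩)
  · exact Or.inr (Or.inl ⟨k1, k2, by linarith, by linarith⟩)
  · exact Or.inl (Or.inr ⟨k1, k2, by linarith, by linarith⟩)
  · exact Or.inl (Or.inl ⟨k1, k2, by linarith, by linarith⟩)

/-- A function invariant under swapping and vanishing on the diagonal integrates over the triangle
to half of its integral over the square. -/
theorem setIntegral_openTriangle_of_swap_invariant {K : ℝ × ℝ → ℝ} (hsymm : ∀ p, K p.swap = K p)
    (hdiag : ∀ a, K (a, a) = 0)
    (hK : IntegrableOn K (Icc (-1:ℝ) 1 ×ˢ Icc (-1:ℝ) 1)) :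
    ∫ p in openTriangle, K p = 1 / 2 * ∫ p in Icc (-1:ℝ) 1 ×ˢ Icc (-1:ℝ) 1, K p := by
  have hsq : (Ioo (-1:ℝ) 1 ×ˢ Ioo (-1:ℝ) 1 : Set (ℝ × ℝ)) =ᵐ[volume]
      (Icc (-1:ℝ) 1 ×ˢ Icc (-1:ℝ) 1 : Set (ℝ × ℝ)) :=
    Measure.set_prod_ae_eq Ioo_ae_eq_Icc Ioo_ae_eq_Icc
  have hmp : MeasurePreserving (Prod.swap : ℝ × ℝ → ℝ × ℝ) volume volume :=
    Measure.measurePreserving_swap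
  have hswap : ∫ p in Prod.swap ⁻¹' openTriangle, K p = ∫ p in openTriangle, K p := by
    rw [← hmp.setIntegral_preimage_emb MeasurableEquiv.prodComm.measurableEmbedding K]
    simp only [hsymm, ← preimage_comp, Prod.swap_swap_eq, preimage_id]
  have hsub : Prod.swap ⁻¹' openTriangle ⊆ Icc (-1:ℝ) 1 ×ˢ Icc (-1:ℝ) 1 := fun p hp =>
    (openTriangle_subset hp).symm
  have hdisj : Disjoint openTriangle (Prod.swap ⁻¹' openTriangle) :=
    Set.disjoint_left.2 fun p h h' => lt_asymm h.2.1 h'.2.1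
  have hm : MeasurableSet (Prod.swap ⁻¹' openTriangle) :=
    measurable_swap measurableSet_openTriangle
  rw [← setIntegral_congr_set hsq, setIntegral_eq_of_subset_of_forall_sdiff_eq_zero
    (s := openTriangle ∪ Prod.swap ⁻¹' openTriangle) (measurableSet_Ioo.prod measurableSet_Ioo),
    setIntegral_union hdisj hm (hK.mono_set openTriangle_subset) (hK.mono_set hsub), hswap]
  · ring
  · rintro p (⟨h1, h2, h3⟩ | ⟨h1, h2, h3⟩)
    · exact ⟨⟨by linarith, h3⟩, h1, by linarith⟩
    · exact ⟨⟨h1, by simp at *; linarith⟩, by simp at *; linarith, h3⟩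
  · rintro ⟨a, b⟩ ⟨⟨ha, hb⟩, h⟩
    rcases lt_trichotomy a b with hab | rfl | hab
    · exact absurd (Or.inr ⟨ha.1, hab, hb.2⟩) h
    · exact hdiag a
    · exact absurd (Or.inl ⟨hb.1, hab, ha.2⟩) h

theorem setIntegral_mul_Wp {w : ℝ → ℝ} (hw : IntegrableOn w (Icc (-1:ℝ) 1))
    {F : ℝ × ℝ → ℝ} (hF : Continuous F) :
    ∫ x in Icc (-1:ℝ) 1 ×ˢ Icc (-1:ℝ) 1, F x * Wp w x =
      ∫ p in openTriangle, 1 / 8 * ((F (branch 1 1 p) + F (branch 1 (-1) p) +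
        F (branch (-1) 1 p) + F (branch (-1) (-1) p)) * (p.1 - p.2) ^ 2 * (w p.1 * w p.2)) := by
  have hsub : (squareSector 1 1 ∪ squareSector 1 (-1)) ∪
      (squareSector (-1) 1 ∪ squareSector (-1) (-1)) ⊆ Icc (-1:ℝ) 1 ×ˢ Icc (-1:ℝ) 1 := by
    have : ∀ ε δ, squareSector ε δ ⊆ Icc (-1:ℝ) 1 ×ˢ Icc (-1:ℝ) 1 := fun ε δ x ⟨h1, h2, _, _⟩ =>
      ⟨abs_le.1 ((sq_lt_one_iff_abs_lt_one _).1 h1).le,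
        abs_le.1 ((sq_lt_one_iff_abs_lt_one _).1 h2).le⟩
    exact union_subset (union_subset (this _ _) (this _ _)) (union_subset (this _ _) (this _ _))
  have i1 : (1:ℝ) ^ 2 = 1 := by norm_num
  have i2 : (-1:ℝ) ^ 2 = 1 := by norm_num
  have hm := measurableSet_squareSector
  rw [setIntegral_eq_of_subset_of_forall_sdiff_eq_zero
    (measurableSet_Icc.prod measurableSet_Icc) hsub
    (fun x hx => by rw [Wp_eq_zero hx.1 hx.2, mul_zero]),
    setIntegral_union (Disjoint.union_left
      (Disjoint.union_right disjoint_squareSector_left disjoint_squareSector_left)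
      (Disjoint.union_right disjoint_squareSector_left disjoint_squareSector_left))
      ((hm _ _).union (hm _ _))
      ((integrableOn_squareSector hw hF i1 i1).union (integrableOn_squareSector hw hF i1 i2))
      ((integrableOn_squareSector hw hF i2 i1).union (integrableOn_squareSector hw hF i2 i2)),
    setIntegral_union disjoint_squareSector_right (hm _ _)
      (integrableOn_squareSector hw hF i1 i1) (integrableOn_squareSector hw hF i1 i2),
    setIntegral_union disjoint_squareSector_right (hm _ _)
      (integrableOn_squareSector hw hF i2 i1) (integrableOn_squareSector hw hF i2 i2),
    setIntegral_squareSector w F i1 i1, setIntegral_squareSector w F i1 i2,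
    setIntegral_squareSector w F i2 i1, setIntegral_squareSector w F i2 i2]
  have hi : ∀ ε δ, IntegrableOn (fun p : ℝ × ℝ =>
      1 / 8 * (F (branch ε δ p) * (p.1 - p.2) ^ 2 * (w p.1 * w p.2))) openTriangle :=
    fun ε δ => (integrableOn_branch hw hF ε δ).mono_set openTriangle_subset
  have hi' : ∀ ε, IntegrableOn (fun p : ℝ × ℝ =>
      1 / 8 * (F (branch ε 1 p) * (p.1 - p.2) ^ 2 * (w p.1 * w p.2)) +
      1 / 8 * (F (branch ε (-1) p) * (p.1 - p.2) ^ 2 * (w p.1 * w p.2))) openTriangle :=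
    fun ε => (hi ε 1).add (hi ε (-1))
  rw [← integral_add (hi _ _) (hi _ _), ← integral_add (hi _ _) (hi _ _),
    ← integral_add (hi' 1) (hi' (-1))]
  refine integral_congr_ae (.of_forall fun p => ?_)
  simp only
  ring

theorem setIntegral_mul_Wp_eq_sum {w : ℝ → ℝ} (hw : IntegrableOn w (Icc (-1:ℝ) 1))
    {m n : ℕ} (hm : 1 ≤ m) (t lam : Fin n → ℝ)
    (hquad : ∀ g : Polynomial ℝ, g.natDegree ≤ 2*m + 1 →
      (∫ u in Icc (-1:ℝ) 1, g.eval u * w u) = ∑ k, lam k * g.eval (t k))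
    {s τ : Fin n → Fin n → ℝ}
    (hsum : ∀ j k, t j + t k = 2 * (s j k * τ j k))
    (hprod : ∀ j k, t j * t k = s j k ^ 2 + τ j k ^ 2 - 1)
    (hs : ∀ j k, s j k = s k j) (hτ : ∀ j k, τ j k = τ k j)
    (f : MvPolynomial (Fin 2) ℝ) (hf : f.totalDegree ≤ 4 * m - 1) :
    (∫ x in (Icc (-1:ℝ) 1) ×ˢ (Icc (-1:ℝ) 1), MvPolynomial.eval ![x.1, x.2] f * Wp w x) =
      (1/8) * ∑ q ∈ Finset.univ.filter (fun q : Fin n × Fin n => q.1 < q.2),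
        lam q.1 * lam q.2 * (t q.1 - t q.2) ^ 2 *
          (MvPolynomial.eval ![s q.1 q.2, τ q.1 q.2] f +
           MvPolynomial.eval ![τ q.1 q.2, s q.1 q.2] f +
           MvPolynomial.eval ![-s q.1 q.2, -τ q.1 q.2] f +
           MvPolynomial.eval ![-τ q.1 q.2, -s q.1 q.2] f) := by
  obtain ⟨G, hG, hGf⟩ := exists_orbitSum hm f hf
  set F : ℝ × ℝ → ℝ := fun x => MvPolynomial.eval ![x.1, x.2] f with hFdef
  have hF : Continuous F := (MvPolynomial.continuous_eval f).comp
    (continuous_pi fun i => by fin_cases i <;> simp <;> fun_prop)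
  have hH : (G * (MvPolynomial.X 0 - MvPolynomial.X 1) ^ 2) ∈
      MvPolynomial.restrictDegree (Fin 2) ℝ (2 * m + 1) := by
    have h1 : (MvPolynomial.X 0 - MvPolynomial.X 1 : MvPolynomial (Fin 2) ℝ) ∈
        MvPolynomial.restrictDegree (Fin 2) ℝ 1 :=
      Submodule.sub_mem _ (X_mem_restrictDegree 0) (X_mem_restrictDegree 1)
    have h2 := mul_mem_restrictDegree hG (mul_mem_restrictDegree h1 h1)
    rw [← sq] at h2
    exact restrictDegree_mono (by omega) h2
  have hbranch : ∀ p ∈ Icc (-1:ℝ) 1 ×ˢ Icc (-1:ℝ) 1, F (branch 1 1 p) + F (branch 1 (-1) p) +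
      F (branch (-1) 1 p) + F (branch (-1) (-1) p) = MvPolynomial.eval ![p.1, p.2] G := by
    intro p hp
    rw [← hGf _ _ _ _ (branch_mul (one_pow 2) (one_pow 2) hp)
      (branch_sq_add_sq (one_pow 2) (one_pow 2) hp)]
    have e1 : branch 1 (-1) p = (branch 1 1 p).swap := by
      ext <;> simp only [branch, Prod.swap] <;> ring
    have e2 : branch (-1) 1 p = -(branch 1 1 p).swap := by
      ext <;> simp only [branch, Prod.swap, Prod.fst_neg, Prod.snd_neg] <;> ring
    have e3 : branch (-1) (-1) p = -branch 1 1 p := by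
      ext <;> simp only [branch, Prod.fst_neg, Prod.snd_neg] <;> ring
    rw [e1, e2, e3]
    simp only [hFdef, Prod.fst_neg, Prod.snd_neg, Prod.fst_swap, Prod.snd_swap]
    ring
  have hint : IntegrableOn (fun p : ℝ × ℝ => 1 / 8 * ((F (branch 1 1 p) + F (branch 1 (-1) p) +
        F (branch (-1) 1 p) + F (branch (-1) (-1) p)) * (p.1 - p.2) ^ 2 * (w p.1 * w p.2)))
      (Icc (-1:ℝ) 1 ×ˢ Icc (-1:ℝ) 1) := by
    have hi := integrableOn_branch hw hF
    exact ((((hi 1 1).add (hi 1 (-1))).add (hi (-1) 1)).add (hi (-1) (-1))).congr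
      (.of_forall fun p => by simp only [Pi.add_apply]; ring)
  rw [setIntegral_mul_Wp hw hF, setIntegral_openTriangle_of_swap_invariant _ _ hint]
  · rw [setIntegral_congr_fun (g := fun p : ℝ × ℝ => 1 / 8 * (MvPolynomial.eval ![p.1, p.2]
        (G * (MvPolynomial.X 0 - MvPolynomial.X 1) ^ 2) * (w p.1 * w p.2)))
      (measurableSet_Icc.prod measurableSet_Icc) (fun p hp => by simp [hbranch p hp]),
      integral_const_mul, setIntegral_prod_eq_sum isCompact_Icc hw t lam hquad hH,
      sum_sum_eq_two_mul_sum_lt, ← mul_assoc, ← mul_assoc]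
    · congr 1
      · norm_num
      · refine Finset.sum_congr rfl fun q _ => ?_
        rw [hGf _ _ _ _ (hsum q.1 q.2) (hprod q.1 q.2)]
        simp
        ring
    · intro j k
      have e := hGf _ _ _ _ (hsum j k) (hprod j k)
      rw [hs j k, hτ j k, hGf _ _ _ _ (hsum k j) (hprod k j)] at e
      simp [e]
      ring
    · simp
  · intro p
    simp only [branch_swap, Prod.fst_swap, Prod.snd_swap]
    ring
  · simp

/-- The orbit of a point under the group generated by swapping and negating the coordinates. -/
def orbitPoint (x y : ℝ) : Fin 4 → ℝ × ℝ := ![(x, y), (y, x), (-x, -y), (-y, -x)]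

theorem orbitPoint_invariants (x y : ℝ) (i : Fin 4) :
    (orbitPoint x y i).1 * (orbitPoint x y i).2 = x * y ∧
      (orbitPoint x y i).1 ^ 2 + (orbitPoint x y i).2 ^ 2 = x ^ 2 + y ^ 2 := by
  fin_cases i <;> simp [orbitPoint, mul_comm, add_comm]

theorem orbitPoint_injective {x y : ℝ} (h1 : 0 < x + y) (h2 : 0 < x - y) :
    Function.Injective (orbitPoint x y) := by
  intro i j h
  fin_cases i <;> fin_cases j <;> simp [orbitPoint] at h ⊢ <;> linarith [h.1, h.2]

theorem orbitPoint_nodes {m : ℕ} {t : Fin (m + 1) → ℝ} (htinj : Function.Injective t)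
    {s τ : Fin (m + 1) → Fin (m + 1) → ℝ}
    (hsum : ∀ j k, t j + t k = 2 * (s j k * τ j k))
    (hprod : ∀ j k, t j * t k = s j k ^ 2 + τ j k ^ 2 - 1)
    (hadd : ∀ j k, 0 < s j k + τ j k) (hsub : ∀ j k, 0 < s j k - τ j k) :
    (let X : Set (ℝ × ℝ) := {z | ∃ j k : Fin (m+1), j < k ∧
        (z = (s j k, τ j k) ∨ z = (τ j k, s j k) ∨
         z = (-s j k, -τ j k) ∨ z = (-τ j k, -s j k))};
      X.Finite ∧ X.ncard = 2 * m * (m + 1)) := by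
  intro X
  set S := (Finset.univ.filter (fun q : Fin (m + 1) × Fin (m + 1) => q.1 < q.2)) ×ˢ
    (Finset.univ : Finset (Fin 4))
  have hX : X = (fun a : (Fin (m + 1) × Fin (m + 1)) × Fin 4 =>
      orbitPoint (s a.1.1 a.1.2) (τ a.1.1 a.1.2) a.2) '' (S : Set _) := by
    ext z
    simp only [X, S, Set.mem_ofPred_eq, Set.mem_image, Finset.mem_coe, Finset.mem_product,
      Finset.mem_filter, Finset.mem_univ, true_and, and_true, Prod.exists, Fin.exists_fin_succ,
      orbitPoint]
    simp [and_or_left, eq_comm]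
  have hinj : InjOn (fun a : (Fin (m + 1) × Fin (m + 1)) × Fin 4 =>
      orbitPoint (s a.1.1 a.1.2) (τ a.1.1 a.1.2) a.2) (S : Set _) := by
    rintro ⟨⟨j, k⟩, a⟩ h ⟨⟨j', k'⟩, a'⟩ h' e
    simp only [S, Finset.mem_coe, Finset.mem_product, Finset.mem_filter, Finset.mem_univ,
      true_and, and_true] at h h' e
    obtain ⟨i1, i2⟩ := orbitPoint_invariants (s j k) (τ j k) a
    obtain ⟨i1', i2'⟩ := orbitPoint_invariants (s j' k') (τ j' k') a'
    rw [e] at i1 i2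
    have e1 : t j + t k = t j' + t k' := by rw [hsum, hsum, ← i1, ← i1']
    have e2 : t j * t k = t j' * t k' := by rw [hprod, hprod, ← i2, ← i2']
    have e3 : (t j - t j') * (t j - t k') = 0 := by linear_combination t j * e1 - e2
    rcases mul_eq_zero.1 e3 with e4 | e4
    · obtain rfl := htinj (sub_eq_zero.1 e4)
      obtain rfl := htinj (add_left_cancel e1)
      rw [orbitPoint_injective (hadd j k) (hsub j k) e]
    · have hj := htinj (sub_eq_zero.1 e4)
      have hk : k = j' := htinj (by linarith)
      exact absurd h (by rw [hj, hk]; exact h'.not_gt)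
  rw [hX]
  refine ⟨S.finite_toSet.image _, ?_⟩
  rw [hinj.ncard_image, ncard_coe_finset, Finset.card_product, Finset.card_univ,
    Fintype.card_fin, ← card_filter_fst_lt_snd, mul_comm]

theorem stmt13 (w : ℝ → ℝ)
    (hw_nonneg : ∀ t ∈ Icc (-1:ℝ) 1, 0 ≤ w t)
    (hw_int : IntegrableOn w (Icc (-1:ℝ) 1))
    (hw_ne : ¬ (w =ᵐ[volume.restrict (Icc (-1:ℝ) 1)] 0))
    (m : ℕ) (hm : 1 ≤ m)
    (t : Fin (m+1) → ℝ) (lam : Fin (m+1) → ℝ)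
    (ht : ∀ k, t k ∈ Ioo (-1:ℝ) 1) (htinj : Function.Injective t)
    (hlam : ∀ k, 0 < lam k)
    (hquad : ∀ g : Polynomial ℝ, g.natDegree ≤ 2*m + 1 →
      (∫ u in Icc (-1:ℝ) 1, g.eval u * w u) = ∑ k, lam k * g.eval (t k))
    (θ : Fin (m+1) → ℝ) (hθ : ∀ k, θ k = Real.arccos (t k))
    (s τ : Fin (m+1) → Fin (m+1) → ℝ)
    (hs : ∀ j k, s j k = Real.cos ((θ j - θ k) / 2))
    (hτ : ∀ j k, τ j k = Real.cos ((θ j + θ k) / 2)) :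
    -- the minimal cubature rule of degree 4m−1 for W_{1/2}
    (∀ f : MvPolynomial (Fin 2) ℝ, f.totalDegree ≤ 4*m - 1 →
      (∫ x in (Icc (-1:ℝ) 1) ×ˢ (Icc (-1:ℝ) 1),
        MvPolynomial.eval ![x.1, x.2] f * Wp w x) =
      (1/8) * ∑ q ∈ Finset.univ.filter (fun q : Fin (m+1) × Fin (m+1) => q.1 < q.2),
        lam q.1 * lam q.2 * (Real.cos (θ q.1) - Real.cos (θ q.2))^2 *
          (MvPolynomial.eval ![s q.1 q.2, τ q.1 q.2] f +
           MvPolynomial.eval ![τ q.1 q.2, s q.1 q.2] f +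
           MvPolynomial.eval ![-s q.1 q.2, -τ q.1 q.2] f +
           MvPolynomial.eval ![-τ q.1 q.2, -s q.1 q.2] f)) ∧
    -- the nodes are 2m(m+1) distinct points, attaining Möller's lower bound
    (let X : Set (ℝ × ℝ) := {z | ∃ j k : Fin (m+1), j < k ∧
        (z = (s j k, τ j k) ∨ z = (τ j k, s j k) ∨
         z = (-s j k, -τ j k) ∨ z = (-τ j k, -s j k))};
      X.Finite ∧ X.ncard = 2 * m * (m + 1)) := by
  have hcos : ∀ k, Real.cos (θ k) = t k := fun k => by
    rw [hθ, Real.cos_arccos (ht k).1.le (ht k).2.le]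
  have hθ0 : ∀ k, 0 < θ k := fun k => by rw [hθ]; exact Real.arccos_pos.2 (ht k).2
  have hθπ : ∀ k, θ k < Real.pi := fun k => by rw [hθ]; exact Real.arccos_lt_pi.2 (ht k).1
  have hc : ∀ k, 0 < Real.cos (θ k / 2) := fun k =>
    Real.cos_pos_of_mem_Ioo ⟨by linarith [hθ0 k, Real.pi_pos], by linarith [hθπ k]⟩
  have hsn : ∀ k, 0 < Real.sin (θ k / 2) := fun k =>
    Real.sin_pos_of_pos_of_lt_pi (by linarith [hθ0 k]) (by linarith [hθπ k, Real.pi_pos])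
  have hs' : ∀ j k, s j k = Real.cos (θ j / 2) * Real.cos (θ k / 2) +
      Real.sin (θ j / 2) * Real.sin (θ k / 2) := fun j k => by
    rw [hs, sub_div, Real.cos_sub]
  have hτ' : ∀ j k, τ j k = Real.cos (θ j / 2) * Real.cos (θ k / 2) -
      Real.sin (θ j / 2) * Real.sin (θ k / 2) := fun j k => by
    rw [hτ, add_div, Real.cos_add]
  have ht' : ∀ k, t k = 2 * Real.cos (θ k / 2) ^ 2 - 1 := fun k => by
    rw [← hcos, ← Real.cos_two_mul]; congr 1; ring
  have hsin : ∀ k, Real.sin (θ k / 2) ^ 2 = 1 - Real.cos (θ k / 2) ^ 2 := fun k =>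
    Real.sin_sq _
  have hsum : ∀ j k, t j + t k = 2 * (s j k * τ j k) := fun j k => by
    rw [hs', hτ', ht', ht']
    linear_combination 2 * Real.sin (θ k / 2) ^ 2 * hsin j +
      2 * (1 - Real.cos (θ j / 2) ^ 2) * hsin k
  have hprod : ∀ j k, t j * t k = s j k ^ 2 + τ j k ^ 2 - 1 := fun j k => by
    rw [hs', hτ', ht', ht']
    linear_combination -2 * Real.sin (θ k / 2) ^ 2 * hsin j -
      2 * (1 - Real.cos (θ j / 2) ^ 2) * hsin k
  refine ⟨fun f hf => ?_, orbitPoint_nodes htinj hsum hprod (fun j k => ?_) (fun j k => ?_)⟩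
  · simp only [hcos]
    exact setIntegral_mul_Wp_eq_sum hw_int hm t lam hquad hsum hprod
      (fun j k => by rw [hs', hs']; ring) (fun j k => by rw [hτ', hτ']; ring) f hf
  · rw [hs', hτ']
    linarith [mul_pos (hc j) (hc k)]
  · rw [hs', hτ']
    linarith [mul_pos (hsn j) (hsn k)]

end
end

section
/- Let ℓ ≥ 1 be an integer and let T_ℓ denote the Chebyshev polynomial of the first kind of degree ℓ. Then for every continuous function f : [-1,1] → ℝ, ∫_{-1}^{1} f(T_ℓ(t)) (1−t²)^{-1/2} dt = ∫_{-1}^{1} f(t) (1−t²)^{-1/2} dt. -/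
open MeasureTheory Set Polynomial

/-- The integral over `[0, n * π]` of an even continuous `2π`-periodic function is `n` times its
integral over `[0, π]`. -/
theorem intervalIntegral_zero_nat_mul_pi_of_even_of_periodic {g : ℝ → ℝ} (hg : Continuous g)
    (heven : ∀ x, g (-x) = g x) (hper : Function.Periodic g (2 * Real.pi)) (n : ℕ) :
    ∫ θ in (0:ℝ)..n * Real.pi, g θ = n * ∫ θ in (0:ℝ)..Real.pi, g θ := by
  have hsymm (a : ℝ) : ∫ θ in (-a)..a, g θ = 2 * ∫ θ in (0:ℝ)..a, g θ := by
    have hneg : ∫ θ in (-a)..0, g θ = ∫ θ in (0:ℝ)..a, g θ := by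
      simpa [heven] using (intervalIntegral.integral_comp_neg (a := 0) (b := a) g).symm
    rw [← intervalIntegral.integral_add_adjacent_intervals (hg.intervalIntegrable (-a) 0)
      (hg.intervalIntegrable 0 a), hneg, two_mul]
  have h := hper.intervalIntegral_add_zsmul_eq n (-(n * Real.pi))
    (fun a b ↦ hg.intervalIntegrable a b)
  have h₁ : -(n * Real.pi) + (n : ℤ) • (2 * Real.pi) = n * Real.pi := by
    simp only [zsmul_eq_mul, Int.cast_natCast]; ring
  have h₂ : -Real.pi + 2 * Real.pi = Real.pi := by ring
  rw [h₁, hsymm, hper.intervalIntegral_add_eq (-(n * Real.pi)) (-Real.pi), h₂, hsymm,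
    zsmul_eq_mul, Int.cast_natCast] at h
  linarith

theorem setIntegral_Icc_mul_rpow_eq_integral_cos (g : ℝ → ℝ) :
    ∫ t in Icc (-1:ℝ) 1, g t * (1 - t^2) ^ (-(1:ℝ)/2) =
      ∫ θ in (0:ℝ)..Real.pi, g (Real.cos θ) := by
  rw [← Chebyshev.integral_measureT_eq_integral_cos, Chebyshev.integral_measureT,
    intervalIntegral.integral_of_le (by norm_num), ← integral_Icc_eq_integral_Ioc]
  refine setIntegral_congr_fun measurableSet_Icc fun t ht ↦ ?_
  have hpos : 0 ≤ 1 - t ^ 2 := by nlinarith [ht.1, ht.2]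
  simp only [neg_div, Real.rpow_neg hpos, Real.sqrt_eq_rpow, Real.inv_rpow hpos]

theorem stmt15 (ℓ : ℕ) (hℓ : 1 ≤ ℓ)
    (f : ℝ → ℝ) (hf : ContinuousOn f (Icc (-1:ℝ) 1)) :
    (∫ t in Icc (-1:ℝ) 1, f ((Chebyshev.T ℝ ℓ).eval t) * (1 - t^2) ^ (-(1:ℝ)/2)) =
      ∫ t in Icc (-1:ℝ) 1, f t * (1 - t^2) ^ (-(1:ℝ)/2) := by
  have hℓ₀ : (ℓ : ℝ) ≠ 0 := by positivity
  have hg : Continuous fun θ ↦ f (Real.cos θ) :=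
    hf.comp_continuous Real.continuous_cos Real.cos_mem_Icc
  rw [setIntegral_Icc_mul_rpow_eq_integral_cos f,
    setIntegral_Icc_mul_rpow_eq_integral_cos fun t ↦ f ((Chebyshev.T ℝ ℓ).eval t)]
  simp only [Chebyshev.T_real_cos, Int.cast_natCast]
  rw [intervalIntegral.integral_comp_mul_left (fun θ ↦ f (Real.cos θ)) hℓ₀, mul_zero,
    intervalIntegral_zero_nat_mul_pi_of_even_of_periodic hg (by simp) (fun θ ↦ by simp),
    smul_eq_mul, inv_mul_cancel_left₀ hℓ₀]
end

section
/- Let ℓ ≥ 1 and k ≥ 1 be integers with k not divisible by ℓ, and let T_ℓ, T_k denote the Chebyshev polynomials of the first kind of degrees ℓ and k. Then for every continuous function f : [-1,1] → ℝ, ∫_{-1}^{1} f(T_ℓ(t)) T_k(t) (1−t²)^{-1/2} dt = 0. -/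
open MeasureTheory Set Polynomial

/-- If a `T`-periodic function is multiplied by a constant `w ≠ 1` under some translation, then
its integral over a period vanishes. -/
theorem Function.Periodic.intervalIntegral_eq_zero_of_add_eq_mul {h : ℝ → ℂ} {T c : ℝ} {w : ℂ}
    (hT : Function.Periodic h T) (hw : w ≠ 1) (hc : ∀ x, h (x + c) = w * h x) (a : ℝ) :
    ∫ x in a..a + T, h x = 0 := by
  have hmul : ∫ x in a..a + T, h x = w * ∫ x in a..a + T, h x := by
    rw [← intervalIntegral.integral_const_mul, ← funext hc,
      intervalIntegral.integral_comp_add_right, add_right_comm]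
    exact hT.intervalIntegral_add_eq _ _
  have hprod : (w - 1) * ∫ x in a..a + T, h x = 0 := by linear_combination -hmul
  exact (mul_eq_zero.mp hprod).resolve_left (sub_ne_zero.mpr hw)

theorem Complex.exp_natCast_mul_two_pi_div_mul_I_ne_one {ℓ k : ℕ} (hℓ : ℓ ≠ 0) (h : ¬ ℓ ∣ k) :
    Complex.exp ((k * (2 * Real.pi / ℓ) : ℝ) * Complex.I) ≠ 1 := by
  intro hexp
  obtain ⟨n, hn⟩ := Complex.exp_eq_one_iff.mp hexp
  have hℓ' : (ℓ : ℂ) ≠ 0 := Nat.cast_ne_zero.mpr hℓ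
  have hkn : (k : ℂ) = ℓ * n := by
    refine mul_right_cancel₀ Complex.two_pi_I_ne_zero ?_
    push_cast at hn
    field_simp at hn
    linear_combination (2 * Real.pi * Complex.I) * hn
  exact h (Int.natCast_dvd_natCast.mp ⟨n, mod_cast hkn⟩)

theorem integral_comp_cos_nat_mul_mul_cos_eq_zero {ℓ k : ℕ} (hℓ : ℓ ≠ 0) (h : ¬ ℓ ∣ k)
    {f : ℝ → ℝ} (hf : ContinuousOn f (Icc (-1) 1)) :
    ∫ θ in 0..Real.pi, f (Real.cos (ℓ * θ)) * Real.cos (k * θ) = 0 := by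
  have hcont : Continuous fun θ : ℝ ↦ f (Real.cos (ℓ * θ)) :=
    hf.comp_continuous (by fun_prop) fun θ ↦ Real.cos_mem_Icc _
  set g : ℝ → ℂ := fun θ ↦ f (Real.cos (ℓ * θ)) * Complex.exp ((k * θ : ℝ) * Complex.I) with hg
  have hgcont : Continuous g :=
    (Complex.continuous_ofReal.comp hcont).mul (by fun_prop)
  have hre : ∀ θ, (g θ).re = f (Real.cos (ℓ * θ)) * Real.cos (k * θ) := fun θ ↦ by
    rw [hg, Complex.re_ofReal_mul, Complex.exp_ofReal_mul_I_re]
  have hper : Function.Periodic g (2 * Real.pi) := fun θ ↦ by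
    have hexp : Complex.exp ((k * (θ + 2 * Real.pi) : ℝ) * Complex.I) =
        Complex.exp ((k * θ : ℝ) * Complex.I) :=
      Complex.exp_eq_exp_iff_exists_int.mpr ⟨k, by push_cast; ring⟩
    have hcos : Real.cos (ℓ * (θ + 2 * Real.pi)) = Real.cos (ℓ * θ) := by
      rw [mul_add, Real.cos_add_nat_mul_two_pi]
    simp only [hg, hexp, hcos]
  have hshift : ∀ θ, g (θ + 2 * Real.pi / ℓ) =
      Complex.exp ((k * (2 * Real.pi / ℓ) : ℝ) * Complex.I) * g θ := fun θ ↦ by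
    have harg : (ℓ : ℝ) * (θ + 2 * Real.pi / ℓ) = ℓ * θ + 2 * Real.pi := by field_simp
    simp only [hg, harg, Real.cos_add_two_pi]
    rw [mul_add, Complex.ofReal_add, add_mul, Complex.exp_add]
    ring
  have hzero : ∫ θ in -Real.pi..Real.pi, g θ = 0 := by
    have := hper.intervalIntegral_eq_zero_of_add_eq_mul
      (Complex.exp_natCast_mul_two_pi_div_mul_I_ne_one hℓ h) hshift (-Real.pi)
    rwa [show -Real.pi + 2 * Real.pi = Real.pi by ring] at this
  have hfull : ∫ θ in -Real.pi..Real.pi, f (Real.cos (ℓ * θ)) * Real.cos (k * θ) = 0 := by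
    have := Complex.reCLM.intervalIntegral_comp_comm
      (hgcont.intervalIntegrable (μ := volume) (-Real.pi) Real.pi)
    simpa only [Complex.reCLM_apply, hre, hzero, Complex.zero_re] using this
  have hcont' : Continuous fun θ : ℝ ↦ f (Real.cos (ℓ * θ)) * Real.cos (k * θ) :=
    hcont.mul (by fun_prop)
  have hneg : ∫ θ in -Real.pi..0, f (Real.cos (ℓ * θ)) * Real.cos (k * θ) =
      ∫ θ in 0..Real.pi, f (Real.cos (ℓ * θ)) * Real.cos (k * θ) := by
    simpa using (intervalIntegral.integral_comp_neg (a := 0) (b := Real.pi)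
      fun θ ↦ f (Real.cos (ℓ * θ)) * Real.cos (k * θ)).symm
  rw [← intervalIntegral.integral_add_adjacent_intervals (hcont'.intervalIntegrable _ 0)
    (hcont'.intervalIntegrable _ _), hneg] at hfull
  linarith

theorem stmt16 (ℓ k : ℕ) (hℓ : 1 ≤ ℓ) (hk : 1 ≤ k) (hndvd : ¬ ℓ ∣ k)
    (f : ℝ → ℝ) (hf : ContinuousOn f (Icc (-1:ℝ) 1)) :
    (∫ t in Icc (-1:ℝ) 1,
      f ((Chebyshev.T ℝ ℓ).eval t) * (Chebyshev.T ℝ k).eval t * (1 - t^2) ^ (-(1:ℝ)/2)) = 0 := by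
  have hweight : ∀ t ∈ Ioc (-1 : ℝ) 1, (1 - t ^ 2) ^ (-(1 : ℝ) / 2) = √(1 - t ^ 2)⁻¹ :=
    fun t ht ↦ by
      have : 0 ≤ 1 - t ^ 2 := by nlinarith [ht.1, ht.2]
      rw [neg_div, Real.rpow_neg this, ← Real.sqrt_eq_rpow, Real.sqrt_inv]
  rw [integral_Icc_eq_integral_Ioc,
    setIntegral_congr_fun measurableSet_Ioc fun t ht ↦ by rw [hweight t ht],
    ← intervalIntegral.integral_of_le (by norm_num),
    ← Chebyshev.integral_measureT fun t ↦
      f ((Chebyshev.T ℝ ℓ).eval t) * (Chebyshev.T ℝ k).eval t,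
    Chebyshev.integral_measureT_eq_integral_cos]
  simpa only [Chebyshev.T_real_cos, Int.cast_natCast] using
    integral_comp_cos_nat_mul_mul_cos_eq_zero (Nat.one_le_iff_ne_zero.mp hℓ) hndvd hf
end

section
/- Let ℓ ≥ 1 and m ≥ 1 be integers and let p be a real polynomial of degree m such that ∫_{-1}^{1} p(t) g(t) w(t) dt = 0 for every real polynomial g of degree ≤ m−1. Then the polynomial p∘T_ℓ has degree ℓm and satisfies ∫_{-1}^{1} p(T_ℓ(t)) q(t) w^{(ℓ)}(t) dt = 0 for every real polynomial q of degree ≤ ℓm − 1, where w^{(ℓ)}(t) = w(T_ℓ(t)) · √(1 − T_ℓ(t)²) / √(1 − t²). In other words, the orthogonal polynomial of degree ℓm for the weight w^{(ℓ)} is p_m(w; T_ℓ(t)). -/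
open MeasureTheory Set Polynomial

noncomputable section

/-- The weight `w^{(ℓ)}(t) = w(T_ℓ(t)) √(1 − T_ℓ(t)²) / √(1 − t²)`. -/
def wEll (w : ℝ → ℝ) (ℓ : ℕ) (t : ℝ) : ℝ :=
  w ((Chebyshev.T ℝ ℓ).eval t) * Real.sqrt (1 - ((Chebyshev.T ℝ ℓ).eval t) ^ 2) /
    Real.sqrt (1 - t ^ 2)

theorem setIntegral_Icc_eq_integral_abs_sin_mul_comp_cos (g : ℝ → ℝ) :
    ∫ x in Icc (-1 : ℝ) 1, g x = ∫ θ in 0..Real.pi, |Real.sin θ| * g (Real.cos θ) := by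
  rw [intervalIntegral.integral_of_le Real.pi_pos.le, ← integral_Icc_eq_integral_Ioc,
    ← Real.bijOn_cos.image_eq,
    integral_image_eq_integral_abs_deriv_smul measurableSet_Icc
      (fun x _ => (Real.hasDerivAt_cos x).hasDerivWithinAt) Real.injOn_cos]
  simp

theorem intervalIntegrable_abs_sin_mul_comp_cos {g : ℝ → ℝ}
    (hg : IntegrableOn g (Icc (-1 : ℝ) 1)) :
    IntervalIntegrable (fun θ => |Real.sin θ| * g (Real.cos θ)) volume 0 Real.pi := by
  rw [intervalIntegrable_iff_integrableOn_Icc_of_le Real.pi_pos.le]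
  rw [← Real.bijOn_cos.image_eq,
    integrableOn_image_iff_integrableOn_abs_deriv_smul measurableSet_Icc
      (fun x _ => (Real.hasDerivAt_cos x).hasDerivWithinAt) Real.injOn_cos] at hg
  simpa using hg

theorem Function.Even.intervalIntegrable_neg_self {F : ℝ → ℝ} {a : ℝ} (hF : F.Even)
    (hint : IntervalIntegrable F volume 0 a) : IntervalIntegrable F volume (-a) 0 := by
  have h := (hint.comp_mul_left (c := -1)).symm
  simpa [hF _, div_neg] using h

theorem Function.Even.intervalIntegral_neg_self {F : ℝ → ℝ} {a : ℝ} (hF : F.Even)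
    (hint : IntervalIntegrable F volume 0 a) :
    ∫ x in -a..a, F x = 2 * ∫ x in 0..a, F x := by
  have h : ∫ x in -a..0, F x = ∫ x in 0..a, F x := by
    have := intervalIntegral.integral_comp_neg (a := 0) (b := a) F
    simp only [hF _, neg_zero] at this
    exact this.symm
  rw [← intervalIntegral.integral_add_adjacent_intervals
    (hF.intervalIntegrable_neg_self hint) hint, h, two_mul]

theorem intervalIntegrable_comp_nat_mul {F : ℝ → ℝ} (hper : F.Periodic (2 * Real.pi))
    (hint : IntervalIntegrable F volume (-Real.pi) Real.pi) {ℓ : ℕ} (hℓ : 1 ≤ ℓ) (a b : ℝ) :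
    IntervalIntegrable (fun θ => F (ℓ * θ)) volume a b := by
  have hℓ' : (ℓ : ℝ) ≠ 0 := by positivity
  have h := hper.intervalIntegrable (t := -Real.pi) (by positivity)
    (by convert hint using 1; ring) (ℓ * a) (ℓ * b)
  have h2 := h.comp_mul_left (c := (ℓ : ℝ))
  simpa [hℓ'] using h2

theorem Function.Periodic.intervalIntegral_neg_pi_pi_comp_add {H : ℝ → ℝ}
    (hper : H.Periodic (2 * Real.pi)) (a : ℝ) :
    ∫ θ in -Real.pi..Real.pi, H (θ + a) = ∫ θ in -Real.pi..Real.pi, H θ := by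
  rw [intervalIntegral.integral_comp_add_right]
  have h := hper.intervalIntegral_add_eq (-Real.pi + a) (-Real.pi)
  rwa [show -Real.pi + a + 2 * Real.pi = Real.pi + a by ring,
    show -Real.pi + 2 * Real.pi = Real.pi by ring] at h

theorem periodic_cos_nat_mul (k : ℕ) :
    Function.Periodic (fun θ : ℝ => Real.cos (k * θ)) (2 * Real.pi) := fun θ => by
  simp only [mul_add, Real.cos_add_nat_mul_two_pi]

theorem integral_comp_nat_mul_mul_cos_of_not_dvd {F : ℝ → ℝ} (hper : F.Periodic (2 * Real.pi))
    (hint : IntervalIntegrable F volume (-Real.pi) Real.pi) {ℓ j : ℕ} (hℓ : 1 ≤ ℓ)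
    (hj : ¬ ℓ ∣ j) :
    ∫ θ in -Real.pi..Real.pi, F (ℓ * θ) * Real.cos (j * θ) = 0 := by
  have hℓ' : (ℓ : ℝ) ≠ 0 := by positivity
  set H : ℝ → ℝ := fun θ => F (ℓ * θ) * Real.cos (j * θ) with hH
  set a : ℝ := 2 * Real.pi / ℓ with ha
  have hla : (ℓ : ℝ) * a = 2 * Real.pi := by rw [ha]; field_simp
  have hHper : H.Periodic (2 * Real.pi) := fun θ => by
    have h := hper.nat_mul ℓ (ℓ * θ)
    simp only [hH, mul_add, Real.cos_add_nat_mul_two_pi, h]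
  have hHint : IntervalIntegrable H volume (-Real.pi) Real.pi :=
    (intervalIntegrable_comp_nat_mul hper hint hℓ _ _).mul_continuousOn (by fun_prop)
  have hHint' (b : ℝ) : IntervalIntegrable (fun θ => H (θ + b)) volume (-Real.pi) Real.pi := by
    have h := (hHper.intervalIntegrable (t := -Real.pi) (by positivity)
      (by convert hHint using 1; ring) (-Real.pi + b) (Real.pi + b)).comp_add_right b
        enorm_ne_top
    simpa using h
  have hsum (θ : ℝ) : H (θ + a) + H (θ + -a) = 2 * Real.cos (j * a) * H θ := by
    have h1 : F (ℓ * (θ + a)) = F (ℓ * θ) := by rw [mul_add, hla, hper]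
    have h2 : F (ℓ * (θ + -a)) = F (ℓ * θ) := by
      rw [mul_add, mul_neg, hla, ← sub_eq_add_neg, hper.sub_eq]
    simp only [hH, h1, h2]
    rw [mul_add, mul_add, mul_neg, Real.cos_add, Real.cos_add, Real.cos_neg, Real.sin_neg]
    ring
  have hcos : Real.cos (j * a) ≠ 1 := fun h => by
    obtain ⟨k, hk⟩ := (Real.cos_eq_one_iff _).1 h
    refine hj (Int.natCast_dvd_natCast.1 ⟨k, ?_⟩)
    have h3 : (k : ℝ) * ℓ * (2 * Real.pi) = j * (2 * Real.pi) := by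
      rw [← hla]; linear_combination (ℓ : ℝ) * (hk + k * hla)
    have h4 := mul_right_cancel₀ (by positivity) h3
    rw [mul_comm]
    exact_mod_cast h4.symm
  have hI := intervalIntegral.integral_add (hHint' a) (hHint' (-a))
  simp only [hsum] at hI
  rw [intervalIntegral.integral_const_mul, hHper.intervalIntegral_neg_pi_pi_comp_add,
    hHper.intervalIntegral_neg_pi_pi_comp_add] at hI
  have h0 : (1 - Real.cos (j * a)) * ∫ θ in -Real.pi..Real.pi, H θ = 0 := by
    linear_combination -hI / 2
  exact (mul_eq_zero.1 h0).resolve_left (sub_ne_zero.2 hcos.symm)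

theorem Function.Periodic.intervalIntegral_neg_pi_pi_comp_nat_mul {H : ℝ → ℝ}
    (hper : H.Periodic (2 * Real.pi))
    (hint : IntervalIntegrable H volume (-Real.pi) Real.pi) {ℓ : ℕ} (hℓ : 1 ≤ ℓ) :
    ∫ θ in -Real.pi..Real.pi, H (ℓ * θ) = ∫ θ in -Real.pi..Real.pi, H θ := by
  have hℓ' : (ℓ : ℝ) ≠ 0 := by positivity
  have h2 := hper.intervalIntegral_add_zsmul_eq ℓ (ℓ * -Real.pi)
    (hper.intervalIntegrable (t := -Real.pi) (by positivity) (by convert hint using 1; ring))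
  rw [hper.intervalIntegral_add_eq (ℓ * -Real.pi) (-Real.pi)] at h2
  simp only [natCast_zsmul, nsmul_eq_mul] at h2
  rw [show (ℓ : ℝ) * -Real.pi + ℓ * (2 * Real.pi) = ℓ * Real.pi by ring,
    show -Real.pi + 2 * Real.pi = Real.pi by ring] at h2
  rw [intervalIntegral.integral_comp_mul_left H hℓ', h2, smul_eq_mul, inv_mul_cancel_left₀ hℓ']

theorem integral_comp_nat_mul_mul_cos_eq_zero {F : ℝ → ℝ} (heven : F.Even)
    (hper : F.Periodic (2 * Real.pi)) (hint : IntervalIntegrable F volume 0 Real.pi)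
    {ℓ m : ℕ} (hℓ : 1 ≤ ℓ)
    (horth : ∀ k < m, ∫ θ in 0..Real.pi, F θ * Real.cos (k * θ) = 0) {j : ℕ} (hj : j < ℓ * m) :
    ∫ θ in 0..Real.pi, F (ℓ * θ) * Real.cos (j * θ) = 0 := by
  have hint' : IntervalIntegrable F volume (-Real.pi) Real.pi :=
    (heven.intervalIntegrable_neg_self hint).trans hint
  have hdouble := Function.Even.intervalIntegral_neg_self (a := Real.pi)
    (F := fun θ => F (ℓ * θ) * Real.cos (j * θ)) (fun θ => by simp [heven _])
    ((intervalIntegrable_comp_nat_mul hper hint' hℓ _ _).mul_continuousOn (by fun_prop))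
  suffices ∫ θ in -Real.pi..Real.pi, F (ℓ * θ) * Real.cos (j * θ) = 0 by linarith
  by_cases hdvd : ℓ ∣ j
  · obtain ⟨k, rfl⟩ := hdvd
    have h := Function.Periodic.intervalIntegral_neg_pi_pi_comp_nat_mul
      (hper.mul (periodic_cos_nat_mul k)) (hint'.mul_continuousOn (by fun_prop)) hℓ
    have h2 := Function.Even.intervalIntegral_neg_self (a := Real.pi)
      (F := fun θ => F θ * Real.cos (k * θ)) (fun θ => by simp [heven _])
      (hint.mul_continuousOn (by fun_prop))
    rw [horth k (lt_of_mul_lt_mul_left hj ℓ.zero_le), mul_zero] at h2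
    simp only [Pi.mul_apply] at h
    rw [h2] at h
    rw [← h]
    congr! 3 with θ
    push_cast
    ring_nf
  · exact integral_comp_nat_mul_mul_cos_of_not_dvd hper hint' hℓ hdvd

theorem integral_mul_eval_cos_eq_zero {G : ℝ → ℝ} {a b : ℝ} {n : ℕ}
    (hG : IntervalIntegrable G volume a b)
    (horth : ∀ j < n, ∫ θ in a..b, G θ * Real.cos (j * θ) = 0)
    {q : ℝ[X]} (hq : q.degree < n) :
    ∫ θ in a..b, G θ * q.eval (Real.cos θ) = 0 := by
  have hmem : q ∈ Submodule.span ℝ (Chebyshev.chebyshevTsequence ℝ '' Set.Iio n) := by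
    rw [Polynomial.Sequence.span_degreeLT _ fun i _ =>
      (leadingCoeff_ne_zero.2 ((Chebyshev.chebyshevTsequence ℝ).ne_zero i)).isUnit]
    exact mem_degreeLT.2 hq
  clear hq
  induction hmem using Submodule.span_induction with
  | mem x hx =>
    obtain ⟨j, hj, rfl⟩ := hx
    simpa [Chebyshev.chebyshevTsequence] using horth j hj
  | zero => simp
  | add x y _ _ hx hy =>
    simp only [eval_add, mul_add]
    rw [intervalIntegral.integral_add, hx, hy, add_zero] <;>
      exact hG.mul_continuousOn (Continuous.continuousOn (by fun_prop))
  | smul c x _ hx =>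
    simp only [eval_smul, smul_eq_mul, mul_left_comm _ c]
    rw [intervalIntegral.integral_const_mul, hx, mul_zero]

theorem abs_sin_mul_wEll_cos (w : ℝ → ℝ) (ℓ : ℕ) (θ : ℝ) :
    |Real.sin θ| * wEll w ℓ (Real.cos θ) = |Real.sin (ℓ * θ)| * w (Real.cos (ℓ * θ)) := by
  have hT : (Chebyshev.T ℝ ℓ).eval (Real.cos θ) = Real.cos (ℓ * θ) := by
    simp
  rw [wEll, hT, ← Real.abs_sin_eq_sqrt_one_sub_cos_sq, ← Real.abs_sin_eq_sqrt_one_sub_cos_sq]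
  by_cases hs : Real.sin θ = 0
  · obtain ⟨n, rfl⟩ := Real.sin_eq_zero_iff.1 hs
    have h : Real.sin (ℓ * (n * Real.pi)) = 0 := by
      rw [← mul_assoc]
      exact_mod_cast Real.sin_int_mul_pi (ℓ * n)
    simp [h]
  · have := abs_ne_zero.2 hs
    field_simp

theorem stmt17 (w : ℝ → ℝ)
    (hw_nonneg : ∀ t ∈ Icc (-1:ℝ) 1, 0 ≤ w t)
    (hw_int : IntegrableOn w (Icc (-1:ℝ) 1))
    (hw_ne : ¬ (w =ᵐ[volume.restrict (Icc (-1:ℝ) 1)] 0))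
    (ℓ m : ℕ) (hℓ : 1 ≤ ℓ) (hm : 1 ≤ m)
    (p : Polynomial ℝ) (hpdeg : p.natDegree = m)
    (hporth : ∀ g : Polynomial ℝ, g.natDegree ≤ m - 1 →
      (∫ t in Icc (-1:ℝ) 1, p.eval t * g.eval t * w t) = 0) :
    (p.comp (Chebyshev.T ℝ ℓ)).natDegree = ℓ * m ∧
    ∀ q : Polynomial ℝ, q.natDegree ≤ ℓ * m - 1 →
      (∫ t in Icc (-1:ℝ) 1, p.eval ((Chebyshev.T ℝ ℓ).eval t) * q.eval t * wEll w ℓ t) = 0 := by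
  refine ⟨by simp [natDegree_comp, hpdeg, Chebyshev.natDegree_T, mul_comm], fun q hq => ?_⟩
  have hlm : 0 < ℓ * m := by positivity
  have hqdeg : q.degree < (ℓ * m : ℕ) :=
    degree_le_natDegree.trans_lt (by exact_mod_cast (by lia : q.natDegree < ℓ * m))
  set F : ℝ → ℝ := fun θ => |Real.sin θ| * (p.eval (Real.cos θ) * w (Real.cos θ)) with hF
  have heven : F.Even := fun θ => by simp [hF]
  have hper : F.Periodic (2 * Real.pi) := fun θ => by simp [hF]
  have hint : IntervalIntegrable F volume 0 Real.pi :=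
    intervalIntegrable_abs_sin_mul_comp_cos
      (hw_int.continuousOn_mul p.continuousOn isCompact_Icc)
  have horth : ∀ k < m, ∫ θ in 0..Real.pi, F θ * Real.cos (k * θ) = 0 := fun k hk => by
    have h := hporth (Chebyshev.T ℝ k) (by rw [Chebyshev.natDegree_T]; simp; lia)
    rw [setIntegral_Icc_eq_integral_abs_sin_mul_comp_cos] at h
    rw [← h]
    congr! 2 with θ
    simp [hF]
    ring
  have hint' : IntervalIntegrable F volume (-Real.pi) Real.pi :=
    (heven.intervalIntegrable_neg_self hint).trans hint
  have hzero : ∫ θ in 0..Real.pi, F (ℓ * θ) * q.eval (Real.cos θ) = 0 :=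
    integral_mul_eval_cos_eq_zero (intervalIntegrable_comp_nat_mul hper hint' hℓ _ _)
      (fun j hj => integral_comp_nat_mul_mul_cos_eq_zero heven hper hint hℓ horth hj) hqdeg
  rw [setIntegral_Icc_eq_integral_abs_sin_mul_comp_cos, ← hzero]
  congr! 2 with θ
  have hw := abs_sin_mul_wEll_cos w ℓ θ
  have hT : (Chebyshev.T ℝ ℓ).eval (Real.cos θ) = Real.cos (ℓ * θ) := by simp
  simp only [hF, hT]
  linear_combination p.eval (Real.cos (ℓ * θ)) * q.eval (Real.cos θ) * hw

end
end
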